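/- Let (Ω, F, (F_t)_{t≥0}, P) be a filtered probability space carrying a standard one-dimensional Brownian motion W, let x ∈ ℝ, and let b : ℝ × ℝ → ℝ be a bounded measurable function such that for each fixed first argument x' ∈ ℝ, the map y ↦ b(x',y) is strictly increasing on the set {y ∈ ℝ : y ≥ x'}. If X and Y are two continuous (F_t)-adapted processes both satisfying, almost surely for all t ≥ 0, Z_t = x + W_t + ∫_0^t b(Z_s, sup_{0≤u≤s} Z_u) ds (with Z = X and Z = Y respectively), then X and Y are indistinguishable: almost surely X_t = Y_t for all t ≥ 0. -/

import Mathlib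

open Set MeasureTheory ProbabilityTheory

/-- A standard one-dimensional Brownian motion `W` on a filtered probability space:
continuous paths, `W 0 = 0`, adapted, and for `0 ≤ s ≤ t` the increment `W t - W s`
is independent of `ℱ s` and has Gaussian law `N(0, t - s)`. -/
def IsStandardBrownianMotion {Ω : Type*} {m : MeasurableSpace Ω}
    (P : Measure Ω) (ℱ : Filtration ℝ m) (W : ℝ → Ω → ℝ) : Prop :=
  (∀ ω, Continuous fun t => W t ω) ∧
  (∀ ω, W 0 ω = 0) ∧
  Adapted ℱ W ∧
  (∀ s t : ℝ, 0 ≤ s → s ≤ t →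
    Indep (MeasurableSpace.comap (fun ω => W t ω - W s ω) Real.measurableSpace)
      (ℱ s) P) ∧
  (∀ s t : ℝ, 0 ≤ s → s ≤ t →
    P.map (fun ω => W t ω - W s ω) = gaussianReal 0 (Real.toNNReal (t - s)))

/-- Bounded measurable `g : ℝ → ℝ → ℝ` vanishing when the first variable leaves `[-S, S]`. -/
structure IsStripBounded (C S : ℝ) (g : ℝ → ℝ → ℝ) : Prop where
  meas : Measurable (Function.uncurry g)
  bdd : ∀ u m, |g u m| ≤ C
  supp : ∀ u m, S < |u| → g u m = 0

/-- The primitive in the first variable. -/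
noncomputable def primitive (g : ℝ → ℝ → ℝ) (v m : ℝ) : ℝ := ∫ u in Iic v, g u m

/-- The density of the scale function of `d z = d w + g(z, m) d t` at frozen level `m`. -/
noncomputable def scaleDensity (g : ℝ → ℝ → ℝ) (v m : ℝ) : ℝ := Real.exp (-2 * primitive g v m)

/-- The harmonic function of the pair (process, running maximum) associated with the
drift `g`, normalised to vanish at `(x, x)`. -/
noncomputable def maxHarmonic (g : ℝ → ℝ → ℝ) (x z m : ℝ) : ℝ :=
  (∫ v in x..m, scaleDensity g v v) - ∫ v in z..m, scaleDensity g v m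

namespace IsStripBounded

variable {C S : ℝ} {f g : ℝ → ℝ → ℝ}

lemma nonneg (hg : IsStripBounded C S g) : 0 ≤ C := (abs_nonneg _).trans (hg.bdd 0 0)

lemma measurable_left (hg : IsStripBounded C S g) (m : ℝ) : Measurable fun u => g u m :=
  hg.meas.comp (measurable_id.prodMk measurable_const)

lemma support_subset (hg : IsStripBounded C S g) (m : ℝ) :
    Function.support (fun u => g u m) ⊆ Icc (-S) S := by
  intro u hu
  by_contra h
  exact hu (hg.supp u m (by
    by_contra! h'
    exact h (abs_le.1 h')))

lemma integrable (hg : IsStripBounded C S g) (m : ℝ) : Integrable fun u => g u m := by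
  rw [← integrableOn_iff_integrable_of_support_subset (hg.support_subset m)]
  exact Measure.integrableOn_of_bounded (M := C) (by simp)
    (hg.measurable_left m).aestronglyMeasurable (ae_of_all _ fun u => hg.bdd u m)

lemma integral_abs_le (hg : IsStripBounded C S g) (hS : 0 ≤ S) (m : ℝ) :
    ∫ u, |g u m| ≤ 2 * C * S := by
  have hsub : Function.support (fun u => |g u m|) ⊆ Icc (-S) S := fun u hu =>
    hg.support_subset m (by simpa using hu)
  rw [← setIntegral_eq_integral_of_forall_compl_eq_zero
    (s := Icc (-S) S) (fun u hu => by by_contra h; exact hu (hsub h))]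
  calc ∫ u in Icc (-S) S, |g u m| ≤ ∫ u in Icc (-S) S, C :=
        setIntegral_mono (hg.integrable m).abs.integrableOn
          (by simp) fun u => hg.bdd u m
    _ = 2 * C * S := by simp [Measure.real, hS]; ring

lemma abs_primitive_le (hg : IsStripBounded C S g) (hS : 0 ≤ S) (v m : ℝ) :
    |primitive g v m| ≤ 2 * C * S :=
  (abs_integral_le_integral_abs).trans <|
    (setIntegral_le_integral (hg.integrable m).abs (ae_of_all _ fun _ => abs_nonneg _)).trans
      (hg.integral_abs_le hS m)

lemma primitive_sub (hg : IsStripBounded C S g) (v v' m : ℝ) :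
    primitive g v' m - primitive g v m = ∫ u in v..v', g u m :=
  intervalIntegral.integral_Iic_sub_Iic (hg.integrable m).integrableOn
    (hg.integrable m).integrableOn

lemma abs_primitive_sub_left_le (hg : IsStripBounded C S g) (v v' m : ℝ) :
    |primitive g v' m - primitive g v m| ≤ C * |v' - v| := by
  rw [hg.primitive_sub]
  exact intervalIntegral.norm_integral_le_of_norm_le_const (f := fun u => g u m)
    fun u _ => hg.bdd u m

lemma scaleDensity_le (hg : IsStripBounded C S g) (hS : 0 ≤ S) (v m : ℝ) :
    scaleDensity g v m ≤ Real.exp (4 * C * S) := by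
  have := abs_le.1 (hg.abs_primitive_le hS v m)
  exact Real.exp_le_exp.2 (by linarith)

lemma le_scaleDensity (hg : IsStripBounded C S g) (hS : 0 ≤ S) (v m : ℝ) :
    (Real.exp (4 * C * S))⁻¹ ≤ scaleDensity g v m := by
  have := abs_le.1 (hg.abs_primitive_le hS v m)
  rw [← Real.exp_neg]
  exact Real.exp_le_exp.2 (by linarith)

end IsStripBounded

lemma scaleDensity_pos (g : ℝ → ℝ → ℝ) (v m : ℝ) : 0 < scaleDensity g v m := Real.exp_pos _

lemma abs_exp_sub_exp_le {a b c : ℝ} (ha : a ≤ c) (hb : b ≤ c) :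
    |Real.exp a - Real.exp b| ≤ Real.exp c * |a - b| := by
  wlog hab : b ≤ a generalizing a b
  · rw [abs_sub_comm, abs_sub_comm a]
    exact this hb ha (le_of_not_ge hab)
  rw [abs_of_nonneg (sub_nonneg.2 (Real.exp_le_exp.2 hab)), abs_of_nonneg (sub_nonneg.2 hab)]
  have h1 : Real.exp b = Real.exp a * Real.exp (b - a) := by rw [← Real.exp_add]; ring_nf
  have h2 := Real.add_one_le_exp (b - a)
  have h3 := Real.exp_le_exp.2 ha
  have h4 := Real.exp_pos a
  nlinarith

namespace IsStripBounded

variable {C S : ℝ} {f g : ℝ → ℝ → ℝ}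

lemma abs_scaleDensity_sub_le (hf : IsStripBounded C S f) (hg : IsStripBounded C S g)
    (hS : 0 ≤ S) (v v' m m' : ℝ) :
    |scaleDensity f v m - scaleDensity g v' m'|
      ≤ 2 * Real.exp (4 * C * S) * |primitive f v m - primitive g v' m'| := by
  have h1 := abs_le.1 (hf.abs_primitive_le hS v m)
  have h2 := abs_le.1 (hg.abs_primitive_le hS v' m')
  refine (abs_exp_sub_exp_le (c := 4 * C * S) (by linarith) (by linarith)).trans (le_of_eq ?_)
  rw [← mul_sub, abs_mul]
  norm_num
  ring

lemma abs_scaleDensity_sub_left_le (hg : IsStripBounded C S g) (hS : 0 ≤ S) (v v' m : ℝ) :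
    |scaleDensity g v m - scaleDensity g v' m|
      ≤ 2 * Real.exp (4 * C * S) * C * |v - v'| := by
  refine (hg.abs_scaleDensity_sub_le hg hS v v' m m).trans ?_
  exact (mul_le_mul_of_nonneg_left (hg.abs_primitive_sub_left_le v' v m)
    (by positivity)).trans_eq (by ring)

lemma continuous_scaleDensity_left (hg : IsStripBounded C S g) (hS : 0 ≤ S) (m : ℝ) :
    Continuous fun v => scaleDensity g v m := by
  have h0 := hg.nonneg
  refine (LipschitzWith.of_dist_le_mul (K := ⟨2 * Real.exp (4 * C * S) * C, by positivity⟩)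
    fun v v' => ?_).continuous
  exact hg.abs_scaleDensity_sub_left_le hS v v' m

lemma measurable_primitive (hg : IsStripBounded C S g) :
    Measurable fun q : ℝ × ℝ => primitive g q.1 q.2 := by
  have h : Measurable fun r : (ℝ × ℝ) × ℝ => (Iic r.1.1).indicator (fun u => g u r.1.2) r.2 := by
    have : (fun r : (ℝ × ℝ) × ℝ => (Iic r.1.1).indicator (fun u => g u r.1.2) r.2)
        = {r : (ℝ × ℝ) × ℝ | r.2 ≤ r.1.1}.indicator (fun r => g r.2 r.1.2) := by
      ext r
      simp [indicator]
    rw [this]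
    exact (hg.meas.comp (measurable_snd.prodMk measurable_fst.snd)).indicator
      (measurableSet_le measurable_snd measurable_fst.fst)
  have := (h.stronglyMeasurable.integral_prod_right' (ν := volume)).measurable
  convert this using 2 with q
  exact (integral_indicator measurableSet_Iic).symm

lemma measurable_scaleDensity (hg : IsStripBounded C S g) :
    Measurable fun q : ℝ × ℝ => scaleDensity g q.1 q.2 :=
  (hg.measurable_primitive.const_mul _).exp

lemma intervalIntegrable_scaleDensity_left (hg : IsStripBounded C S g) (hS : 0 ≤ S)
    (a b m : ℝ) : IntervalIntegrable (fun v => scaleDensity g v m) volume a b :=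
  (hg.continuous_scaleDensity_left hS m).intervalIntegrable a b

lemma intervalIntegrable_scaleDensity_diag (hg : IsStripBounded C S g) (hS : 0 ≤ S)
    (a b : ℝ) : IntervalIntegrable (fun v => scaleDensity g v v) volume a b := by
  refine (intervalIntegrable_const (c := Real.exp (4 * C * S))).mono_fun
    (hg.measurable_scaleDensity.comp (measurable_id.prodMk measurable_id)).aestronglyMeasurable
    (ae_of_all _ fun v => ?_)
  simp only [Real.norm_eq_abs, Real.abs_exp]
  rw [abs_of_pos (scaleDensity_pos g v v)]
  exact hg.scaleDensity_le hS v v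

lemma scaleDensity_anti (hg : IsStripBounded C S g) (hmono : ∀ u, MonotoneOn (g u) (Ici u))
    {v m m' : ℝ} (hv : v ≤ m) (hm : m ≤ m') : scaleDensity g v m' ≤ scaleDensity g v m := by
  have : primitive g v m ≤ primitive g v m' :=
    setIntegral_mono_on (hg.integrable m).integrableOn (hg.integrable m').integrableOn
      measurableSet_Iic fun u hu =>
        hmono u (show u ≤ m from le_trans hu hv) (show u ≤ m' from (le_trans hu hv).trans hm) hm
  exact Real.exp_le_exp.2 (by linarith)

lemma maxHarmonic_sub_left (hg : IsStripBounded C S g) (hS : 0 ≤ S) (x z z' m : ℝ) :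
    maxHarmonic g x z' m - maxHarmonic g x z m = ∫ v in z..z', scaleDensity g v m := by
  have := intervalIntegral.integral_add_adjacent_intervals
    (hg.intervalIntegrable_scaleDensity_left hS z z' m)
    (hg.intervalIntegrable_scaleDensity_left hS z' m m)
  simp only [maxHarmonic]
  linarith

lemma maxHarmonic_sub_right (hg : IsStripBounded C S g) (hS : 0 ≤ S) (x z m m' : ℝ) :
    maxHarmonic g x z m' - maxHarmonic g x z m
      = (∫ v in m..m', (scaleDensity g v v - scaleDensity g v m'))
        + ∫ v in z..m, (scaleDensity g v m - scaleDensity g v m') := by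
  have h1 := intervalIntegral.integral_add_adjacent_intervals
    (hg.intervalIntegrable_scaleDensity_left hS z m m')
    (hg.intervalIntegrable_scaleDensity_left hS m m' m')
  have h2 := intervalIntegral.integral_add_adjacent_intervals
    (hg.intervalIntegrable_scaleDensity_diag hS x m)
    (hg.intervalIntegrable_scaleDensity_diag hS m m')
  rw [intervalIntegral.integral_sub (hg.intervalIntegrable_scaleDensity_diag hS _ _)
      (hg.intervalIntegrable_scaleDensity_left hS _ _ _),
    intervalIntegral.integral_sub (hg.intervalIntegrable_scaleDensity_left hS _ _ _)
      (hg.intervalIntegrable_scaleDensity_left hS _ _ _)]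
  simp only [maxHarmonic]
  linarith

lemma mul_sub_le_maxHarmonic_sub (hg : IsStripBounded C S g) (hS : 0 ≤ S)
    (hmono : ∀ u, MonotoneOn (g u) (Ici u)) {x z z' m m' : ℝ} (hz : z ≤ z') (hm : m ≤ m')
    (hzm : z ≤ m) :
    (Real.exp (4 * C * S))⁻¹ * (z' - z) ≤ maxHarmonic g x z' m' - maxHarmonic g x z m := by
  have h1 := hg.maxHarmonic_sub_left hS x z z' m'
  have h2 := hg.maxHarmonic_sub_right hS x z m m'
  have h3 : (Real.exp (4 * C * S))⁻¹ * (z' - z) ≤ ∫ v in z..z', scaleDensity g v m' := by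
    have := intervalIntegral.integral_mono_on hz
      (intervalIntegrable_const (c := (Real.exp (4 * C * S))⁻¹))
      (hg.intervalIntegrable_scaleDensity_left hS z z' m')
      fun v _ => hg.le_scaleDensity hS v m'
    simpa [mul_comm] using this
  have h4 : 0 ≤ ∫ v in m..m', (scaleDensity g v v - scaleDensity g v m') :=
    intervalIntegral.integral_nonneg hm fun v hv =>
      sub_nonneg.2 (hg.scaleDensity_anti hmono le_rfl hv.2)
  have h5 : 0 ≤ ∫ v in z..m, (scaleDensity g v m - scaleDensity g v m') :=
    intervalIntegral.integral_nonneg hzm fun v hv =>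
      sub_nonneg.2 (hg.scaleDensity_anti hmono hv.2 hm)
  linarith

end IsStripBounded

namespace IsStripBounded

variable {C S : ℝ} {f g : ℝ → ℝ → ℝ}

lemma enorm_primitive_sub_le (hf : IsStripBounded C S f) (hg : IsStripBounded C S g) (v m : ℝ) :
    ‖primitive f v m - primitive g v m‖ₑ ≤ ∫⁻ u in Icc (-S) S, ‖f u m - g u m‖ₑ := by
  rw [primitive, primitive, ← integral_sub (hf.integrable m).integrableOn
    (hg.integrable m).integrableOn]
  refine (enorm_integral_le_lintegral_enorm _).trans ?_
  refine (setLIntegral_le_lintegral _ _).trans (le_of_eq ?_)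
  refine (setLIntegral_eq_of_support_subset fun u hu => ?_).symm
  by_contra h
  have h1 : f u m = 0 := by
    by_contra h1; exact h (hf.support_subset m h1)
  have h2 : g u m = 0 := by
    by_contra h1; exact h (hg.support_subset m h1)
  simp [h1, h2] at hu

lemma enorm_scaleDensity_sub_le (hf : IsStripBounded C S f) (hg : IsStripBounded C S g)
    (hS : 0 ≤ S) (v m : ℝ) :
    ‖scaleDensity f v m - scaleDensity g v m‖ₑ
      ≤ ENNReal.ofReal (2 * Real.exp (4 * C * S)) * ∫⁻ u in Icc (-S) S, ‖f u m - g u m‖ₑ := by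
  calc ‖scaleDensity f v m - scaleDensity g v m‖ₑ
      = ENNReal.ofReal |scaleDensity f v m - scaleDensity g v m| := Real.enorm_eq_ofReal_abs _
    _ ≤ ENNReal.ofReal (2 * Real.exp (4 * C * S) * |primitive f v m - primitive g v m|) :=
        ENNReal.ofReal_le_ofReal (hf.abs_scaleDensity_sub_le hg hS v v m m)
    _ = ENNReal.ofReal (2 * Real.exp (4 * C * S)) * ‖primitive f v m - primitive g v m‖ₑ := by
        rw [ENNReal.ofReal_mul (by positivity), Real.enorm_eq_ofReal_abs]
    _ ≤ _ := by
        gcongr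
        exact hf.enorm_primitive_sub_le hg v m

lemma enorm_maxHarmonic_sub_le (hf : IsStripBounded C S f) (hg : IsStripBounded C S g)
    (hS : 0 ≤ S) {x z m : ℝ} (hx : x ≤ m) (hz : z ≤ m) :
    ‖maxHarmonic f x z m - maxHarmonic g x z m‖ₑ
      ≤ ENNReal.ofReal (2 * Real.exp (4 * C * S)) *
        ((∫⁻ v in Ioc x m, ∫⁻ u in Icc (-S) S, ‖f u v - g u v‖ₑ)
          + ENNReal.ofReal (m - z) * ∫⁻ u in Icc (-S) S, ‖f u m - g u m‖ₑ) := by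
  have h1 : maxHarmonic f x z m - maxHarmonic g x z m
      = (∫ v in x..m, (scaleDensity f v v - scaleDensity g v v))
        - ∫ v in z..m, (scaleDensity f v m - scaleDensity g v m) := by
    rw [intervalIntegral.integral_sub (hf.intervalIntegrable_scaleDensity_diag hS _ _)
        (hg.intervalIntegrable_scaleDensity_diag hS _ _),
      intervalIntegral.integral_sub (hf.intervalIntegrable_scaleDensity_left hS _ _ _)
        (hg.intervalIntegrable_scaleDensity_left hS _ _ _)]
    simp only [maxHarmonic]
    ring
  rw [h1, intervalIntegral.integral_of_le hx, intervalIntegral.integral_of_le hz, mul_add]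
  refine (enorm_sub_le).trans (add_le_add ?_ ?_)
  · refine (enorm_integral_le_lintegral_enorm _).trans ?_
    rw [← lintegral_const_mul' _ _ ENNReal.ofReal_ne_top]
    exact lintegral_mono fun v => hf.enorm_scaleDensity_sub_le hg hS v v
  · refine (enorm_integral_le_lintegral_enorm _).trans ?_
    refine (lintegral_mono fun v => hf.enorm_scaleDensity_sub_le hg hS v m).trans (le_of_eq ?_)
    simp
    ring

end IsStripBounded

/-- Joint Lipschitz continuity for the `ℓ¹` distance on the plane. -/
def IsPlaneLipschitz (L : ℝ) (f : ℝ → ℝ → ℝ) : Prop :=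
  ∀ u u' m m', |f u m - f u' m'| ≤ L * (|u - u'| + |m - m'|)

lemma IsPlaneLipschitz.nonneg {L : ℝ} {f : ℝ → ℝ → ℝ} (h : IsPlaneLipschitz L f) : 0 ≤ L := by
  have := (abs_nonneg _).trans (h 1 0 0 0)
  simpa using this

lemma IsPlaneLipschitz.continuous {L : ℝ} {f : ℝ → ℝ → ℝ} (h : IsPlaneLipschitz L f) :
    Continuous fun q : ℝ × ℝ => f q.1 q.2 := by
  refine (LipschitzWith.of_dist_le_mul (K := ⟨2 * L, by linarith [h.nonneg]⟩)
    fun p q => ?_).continuous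
  have h1 := h p.1 q.1 p.2 q.2
  have h2 : |p.1 - q.1| ≤ dist p q := le_max_left _ _
  have h3 : |p.2 - q.2| ≤ dist p q := le_max_right _ _
  have h4 := h.nonneg
  change |f p.1 p.2 - f q.1 q.2| ≤ 2 * L * dist p q
  nlinarith

lemma IsPlaneLipschitz.mul {L L' B B' : ℝ} {f g : ℝ → ℝ → ℝ} (hf : IsPlaneLipschitz L f)
    (hg : IsPlaneLipschitz L' g) (hfB : ∀ u m, |f u m| ≤ B) (hgB : ∀ u m, |g u m| ≤ B') :
    IsPlaneLipschitz (L * B' + B * L') fun u m => f u m * g u m := by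
  intro u u' m m'
  have h1 : f u m * g u m - f u' m' * g u' m'
      = (f u m - f u' m') * g u m + f u' m' * (g u m - g u' m') := by ring
  rw [h1]
  refine (abs_add_le _ _).trans ?_
  rw [abs_mul, abs_mul]
  have h2 := mul_le_mul (hf u u' m m') (hgB u m) (abs_nonneg _) ((abs_nonneg _).trans (hf _ _ _ _))
  have h3 := mul_le_mul (hfB u' m') (hg u u' m m') (abs_nonneg _) ((abs_nonneg _).trans (hfB 0 0))
  linarith

namespace IsStripBounded

variable {C S L : ℝ} {f : ℝ → ℝ → ℝ}

lemma abs_primitive_sub_right_le (hf : IsStripBounded C S f) (hS : 0 ≤ S)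
    (hL : IsPlaneLipschitz L f) (v m m' : ℝ) :
    |primitive f v m - primitive f v m'| ≤ 2 * S * L * |m - m'| := by
  rw [primitive, primitive, ← integral_sub (hf.integrable m).integrableOn
    (hf.integrable m').integrableOn]
  have hi : Integrable fun u => |f u m - f u m'| := ((hf.integrable m).sub (hf.integrable m')).abs
  refine (abs_integral_le_integral_abs).trans ?_
  refine (setIntegral_le_integral hi (ae_of_all _ fun _ => abs_nonneg _)).trans ?_
  rw [← setIntegral_eq_integral_of_forall_compl_eq_zero (s := Icc (-S) S)]
  · calc ∫ u in Icc (-S) S, |f u m - f u m'| ≤ ∫ u in Icc (-S) S, L * |m - m'| :=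
          setIntegral_mono (f := fun u => |f u m - f u m'|) (g := fun _ => L * |m - m'|)
            hi.integrableOn (integrableOn_const (by simp)) fun u => (hL u u m m').trans_eq (by simp)
      _ = 2 * S * L * |m - m'| := by simp [Measure.real, hS]; ring
  · intro u hu
    have h1 : f u m = 0 := by
      by_contra h1; exact hu (hf.support_subset m h1)
    have h2 : f u m' = 0 := by
      by_contra h1; exact hu (hf.support_subset m' h1)
    simp [h1, h2]

lemma isPlaneLipschitz_scaleDensity (hf : IsStripBounded C S f) (hS : 0 ≤ S)
    (hL : IsPlaneLipschitz L f) :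
    IsPlaneLipschitz (2 * Real.exp (4 * C * S) * (C + 2 * S * L)) (scaleDensity f) := by
  intro u u' m m'
  refine (hf.abs_scaleDensity_sub_le hf hS u u' m m').trans ?_
  refine (mul_le_mul_of_nonneg_left ?_
    (by positivity : 0 ≤ 2 * Real.exp (4 * C * S))).trans_eq (mul_assoc _ _ _).symm
  have h1 := hf.abs_primitive_sub_right_le hS hL u m m'
  have h2 := hf.abs_primitive_sub_left_le u' u m'
  have h3 := abs_add_le (primitive f u m - primitive f u m') (primitive f u m' - primitive f u' m')
  have h4 : 0 ≤ C * |m - m'| := mul_nonneg hf.nonneg (abs_nonneg _)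
  have h5 : 0 ≤ 2 * S * L * |u - u'| :=
    mul_nonneg (mul_nonneg (mul_nonneg (zero_le_two (α := ℝ)) hS) hL.nonneg) (abs_nonneg _)
  rw [sub_add_sub_cancel] at h3
  nlinarith

lemma hasDerivAt_scaleDensity (hf : IsStripBounded C S f) (hL : IsPlaneLipschitz L f)
    (v m : ℝ) :
    HasDerivAt (fun v => scaleDensity f v m) (-2 * (f v m * scaleDensity f v m)) v := by
  have hc : Continuous fun u => f u m := hL.continuous.comp
    (by fun_prop : Continuous fun u : ℝ => (u, m))
  have h1 : HasDerivAt (fun v => primitive f v m) (f v m) v := by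
    have h2 : (fun v => primitive f v m) = fun v => primitive f 0 m + ∫ u in (0:ℝ)..v, f u m := by
      ext v
      rw [← hf.primitive_sub]
      ring
    rw [h2]
    exact (intervalIntegral.integral_hasDerivAt_right (hc.intervalIntegrable _ _)
      (hc.stronglyMeasurableAtFilter _ _) hc.continuousAt).const_add _
  refine ((h1.const_mul (-2)).exp).congr_deriv ?_
  change Real.exp (-2 * primitive f v m) * (-2 * f v m)
    = -2 * (f v m * Real.exp (-2 * primitive f v m))
  ring

lemma abs_integral_scaleDensity_sub_taylor_le (hf : IsStripBounded C S f) (hS : 0 ≤ S)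
    {L' : ℝ} (hL : IsPlaneLipschitz L f)
    (hL' : IsPlaneLipschitz L' fun u m => f u m * scaleDensity f u m) (z δ m : ℝ) :
    |(∫ v in z..z + δ, scaleDensity f v m)
      - (scaleDensity f z m * δ - f z m * scaleDensity f z m * δ ^ 2)| ≤ 2 * L' * |δ| ^ 3 := by
  set c := f z m * scaleDensity f z m with hc
  have hδ : ∀ v ∈ uIcc z (z + δ), |v - z| ≤ |δ| := by
    intro v hv
    have := abs_sub_left_of_mem_uIcc hv
    simpa using this
  have hzmem : z ∈ uIcc z (z + δ) := left_mem_uIcc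
  have h1 : ∀ v ∈ uIcc z (z + δ),
      |scaleDensity f v m - scaleDensity f z m + 2 * c * (v - z)| ≤ 2 * L' * |δ| ^ 2 := by
    intro v hv
    have := (convex_uIcc z (z + δ)).norm_image_sub_le_of_norm_hasDerivWithin_le
      (f := fun v => scaleDensity f v m + 2 * c * (v - z))
      (f' := fun v => -2 * (f v m * scaleDensity f v m) + 2 * c * 1) (C := 2 * L' * |δ|)
      (fun v _ => ((hf.hasDerivAt_scaleDensity hL v m).add
        (((hasDerivAt_id v).sub_const z).const_mul (2 * c))).hasDerivWithinAt)
      (fun v hv => by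
        have h2 := hL' v z m m
        have h3 := hδ v hv
        rw [sub_self, abs_zero, add_zero] at h2
        have : -2 * (f v m * scaleDensity f v m) + 2 * c * 1
          = -2 * (f v m * scaleDensity f v m - f z m * scaleDensity f z m) := by rw [hc]; ring
        rw [this, Real.norm_eq_abs, abs_mul]
        norm_num
        nlinarith [hL'.nonneg]) hzmem hv
    simp only [Real.norm_eq_abs, sub_self, mul_zero, add_zero] at this
    rw [show scaleDensity f v m - scaleDensity f z m + 2 * c * (v - z)
      = scaleDensity f v m + 2 * c * (v - z) - scaleDensity f z m by ring]
    refine this.trans ?_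
    have h3 := hδ v hv
    nlinarith [mul_nonneg hL'.nonneg (abs_nonneg δ)]
  have hcont := hf.continuous_scaleDensity_left hS m
  have := (convex_uIcc z (z + δ)).norm_image_sub_le_of_norm_hasDerivWithin_le
      (f := fun y => (∫ v in z..y, scaleDensity f v m) - (scaleDensity f z m * (y - z)
        - c * (y - z) ^ 2))
      (f' := fun v => scaleDensity f v m - (scaleDensity f z m * 1
        - c * (2 * (v - z) * 1))) (C := 2 * L' * |δ| ^ 2)
      (fun v _ => by
        refine HasDerivAt.hasDerivWithinAt ?_
        refine (intervalIntegral.integral_hasDerivAt_right (hcont.intervalIntegrable _ _)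
          (hcont.stronglyMeasurableAtFilter _ _) hcont.continuousAt).sub ?_
        refine (((hasDerivAt_id v).sub_const z).const_mul _).sub (HasDerivAt.const_mul _ ?_)
        simpa using ((hasDerivAt_id v).sub_const z).fun_pow 2)
      (fun v hv => by
        rw [Real.norm_eq_abs]
        convert h1 v hv using 2
        ring) hzmem (right_mem_uIcc : z + δ ∈ uIcc z (z + δ))
  simp only [intervalIntegral.integral_same, Real.norm_eq_abs, add_sub_cancel_left, sub_self,
    mul_zero] at this
  norm_num at this
  calc _ ≤ _ := this
    _ = _ := by
      rw [← sq_abs δ]; ring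

/-- One step of a discrete Itô formula for `maxHarmonic` along a pair (process, running
maximum). -/
lemma abs_maxHarmonic_step_le (hf : IsStripBounded C S f) (hS : 0 ≤ S)
    {L' L'' : ℝ} (hL : IsPlaneLipschitz L f) (hL'' : IsPlaneLipschitz L'' (scaleDensity f))
    (hL' : IsPlaneLipschitz L' fun u m => f u m * scaleDensity f u m) (x z δ m : ℝ) :
    |maxHarmonic f x (z + δ) (max m (z + δ)) - maxHarmonic f x z m
      - (scaleDensity f z m * δ - f z m * scaleDensity f z m * δ ^ 2)|
    ≤ L'' * (max m (z + δ) - m) ^ 2 + 2 * L' * |δ| ^ 3 := by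
  have h1 := hf.maxHarmonic_sub_left hS x z (z + δ) m
  have h2 := hf.abs_integral_scaleDensity_sub_taylor_le hS hL hL' z δ m
  have h3 : |maxHarmonic f x (z + δ) (max m (z + δ)) - maxHarmonic f x (z + δ) m|
      ≤ L'' * (max m (z + δ) - m) ^ 2 := by
    rcases le_total (z + δ) m with h | h
    · simp [max_eq_left h]
    · rw [max_eq_right h, hf.maxHarmonic_sub_right hS, intervalIntegral.integral_symm m,
        ← sub_eq_add_neg, ← intervalIntegral.integral_sub]
      · have := intervalIntegral.norm_integral_le_of_norm_le_const (a := m) (b := z + δ)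
          (f := fun v => scaleDensity f v v - scaleDensity f v (z + δ)
            - (scaleDensity f v m - scaleDensity f v (z + δ))) (C := L'' * (z + δ - m))
          (fun v hv => by
            rw [uIoc_of_le h] at hv
            have h4 := hL'' v v v m
            rw [sub_self, abs_zero, zero_add, abs_of_nonneg (sub_nonneg.2 hv.1.le)] at h4
            rw [Real.norm_eq_abs, sub_sub_sub_cancel_right]
            refine h4.trans (mul_le_mul_of_nonneg_left ?_ hL''.nonneg)
            linarith [hv.2])
        rw [Real.norm_eq_abs, abs_of_nonneg (sub_nonneg.2 h)] at this
        exact this.trans_eq (by ring)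
      · exact (hf.intervalIntegrable_scaleDensity_diag hS _ _).sub
          (hf.intervalIntegrable_scaleDensity_left hS _ _ _)
      · exact (hf.intervalIntegrable_scaleDensity_left hS _ _ _).sub
          (hf.intervalIntegrable_scaleDensity_left hS _ _ _)
  rw [abs_le] at *
  constructor <;> linarith

lemma continuous_maxHarmonic (hf : IsStripBounded C S f) (hS : 0 ≤ S)
    (hL : IsPlaneLipschitz L f) (x : ℝ) :
    Continuous fun q : ℝ × ℝ => maxHarmonic f x q.1 q.2 := by
  have hc := (hf.isPlaneLipschitz_scaleDensity hS hL).continuous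
  have h1 : Continuous fun v => scaleDensity f v v :=
    hc.comp (by fun_prop : Continuous fun u : ℝ => (u, u))
  have h2 : (fun q : ℝ × ℝ => maxHarmonic f x q.1 q.2) = fun q : ℝ × ℝ =>
      (∫ v in x..q.2, scaleDensity f v v) - ((∫ v in (0:ℝ)..q.2, scaleDensity f v q.2)
        - ∫ v in (0:ℝ)..q.1, scaleDensity f v q.2) := by
    ext q
    rw [intervalIntegral.integral_interval_sub_left
      (hf.intervalIntegrable_scaleDensity_left hS _ _ _)
      (hf.intervalIntegrable_scaleDensity_left hS _ _ _), maxHarmonic]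
  rw [h2]
  have h3 : Continuous (Function.uncurry fun (q : ℝ × ℝ) v => scaleDensity f v q.2) :=
    hc.comp (by fun_prop : Continuous fun r : (ℝ × ℝ) × ℝ => (r.2, r.1.2))
  refine Continuous.sub ?_ (Continuous.sub ?_ ?_)
  · exact (intervalIntegral.continuous_primitive
      (fun a b => h1.intervalIntegrable a b) x).comp continuous_snd
  · exact intervalIntegral.continuous_parametric_intervalIntegral_of_continuous h3 continuous_snd
  · exact intervalIntegral.continuous_parametric_intervalIntegral_of_continuous h3 continuous_fst

lemma abs_maxHarmonic_le (hf : IsStripBounded C S f) (hS : 0 ≤ S) (x z m : ℝ) :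
    |maxHarmonic f x z m| ≤ Real.exp (4 * C * S) * (|x| + |z| + 2 * |m|) := by
  have hb : ∀ a b v : ℝ, ∀ w, ‖scaleDensity f v w‖ ≤ Real.exp (4 * C * S) := by
    intro a b v w
    rw [Real.norm_eq_abs, abs_of_pos (scaleDensity_pos f v w)]
    exact hf.scaleDensity_le hS v w
  have h1 := intervalIntegral.norm_integral_le_of_norm_le_const (a := x) (b := m)
    (f := fun v => scaleDensity f v v) (C := Real.exp (4 * C * S)) (fun v _ => hb 0 0 v v)
  have h2 := intervalIntegral.norm_integral_le_of_norm_le_const (a := z) (b := m)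
    (f := fun v => scaleDensity f v m) (C := Real.exp (4 * C * S)) (fun v _ => hb 0 0 v m)
  have h3 := Real.exp_pos (4 * C * S)
  have h4 := abs_sub m x
  have h5 := abs_sub m z
  have h6 := abs_sub (∫ v in x..m, scaleDensity f v v) (∫ v in z..m, scaleDensity f v m)
  simp only [Real.norm_eq_abs] at h1 h2
  simp only [maxHarmonic]
  nlinarith

lemma maxHarmonic_self (f : ℝ → ℝ → ℝ) (x : ℝ) : maxHarmonic f x x x = 0 := by
  simp [maxHarmonic]

end IsStripBounded

lemma integrable_pow_gaussianReal (v : NNReal) (k : ℕ) :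
    Integrable (fun y => y ^ k) (gaussianReal 0 v) := by
  rcases eq_or_ne k 0 with rfl | hk
  · simp
  · refine ((memLp_id_gaussianReal' (k : ENNReal) (by simp)).integrable_norm_pow hk).mono
      (by fun_prop) (ae_of_all _ fun y => by simp)

lemma integral_sq_gaussianReal (v : NNReal) : ∫ y, y ^ 2 ∂gaussianReal 0 v = v := by
  rw [← variance_id_gaussianReal (μ := 0) (v := v), variance_of_integral_eq_zero (by fun_prop)]
  · rfl
  · simp

lemma integral_pow_four_gaussianReal (v : NNReal) :
    ∫ y, y ^ 4 ∂gaussianReal 0 v = (∫ y, y ^ 4 ∂gaussianReal 0 1) * (v : ℝ) ^ 2 := by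
  have h := gaussianReal_map_const_mul (μ := 0) (v := 1) (Real.sqrt v)
  have h1 : (NNReal.mk (Real.sqrt v ^ 2) (sq_nonneg _)) * 1 = v := by
    ext
    simp
  rw [mul_zero, h1] at h
  rw [← h, integral_map (by fun_prop) (by fun_prop), ← integral_mul_const]
  refine integral_congr_ae (ae_of_all _ fun y => ?_)
  have : Real.sqrt v ^ 4 = (v : ℝ) ^ 2 := by
    rw [show 4 = 2 * 2 by norm_num, pow_mul, Real.sq_sqrt v.coe_nonneg]
  simp only [mul_pow, this]
  ring

namespace IsStandardBrownianMotion

variable {Ω : Type*} {m : MeasurableSpace Ω} {P : Measure Ω} {ℱ : Filtration ℝ m}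
  {W : ℝ → Ω → ℝ}

lemma continuous (hW : IsStandardBrownianMotion P ℱ W) (ω : Ω) : Continuous fun t => W t ω :=
  hW.1 ω

lemma measurable (hW : IsStandardBrownianMotion P ℱ W) (t : ℝ) : Measurable (W t) :=
  hW.2.2.1.measurable

lemma measurable_sub (hW : IsStandardBrownianMotion P ℱ W) (s t : ℝ) :
    Measurable fun ω => W t ω - W s ω := (hW.measurable t).sub (hW.measurable s)

lemma map_sub (hW : IsStandardBrownianMotion P ℱ W) {s t : ℝ} (hs : 0 ≤ s) (hst : s ≤ t) :
    P.map (fun ω => W t ω - W s ω) = gaussianReal 0 (Real.toNNReal (t - s)) :=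
  hW.2.2.2.2 s t hs hst

lemma integrable_sub_pow (hW : IsStandardBrownianMotion P ℱ W) {s t : ℝ} (hs : 0 ≤ s)
    (hst : s ≤ t) (k : ℕ) : Integrable (fun ω => (W t ω - W s ω) ^ k) P := by
  have h := integrable_pow_gaussianReal (Real.toNNReal (t - s)) k
  rw [← hW.map_sub hs hst] at h
  exact (integrable_map_measure (measurable_id.pow_const k).aestronglyMeasurable
    (hW.measurable_sub s t).aemeasurable).1 h

lemma integral_comp_sub (hW : IsStandardBrownianMotion P ℱ W) {s t : ℝ} (hs : 0 ≤ s)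
    (hst : s ≤ t) {φ : ℝ → ℝ} (hφ : Measurable φ) :
    ∫ ω, φ (W t ω - W s ω) ∂P = ∫ y, φ y ∂gaussianReal 0 (Real.toNNReal (t - s)) := by
  rw [← hW.map_sub hs hst, integral_map (hW.measurable_sub s t).aemeasurable
    hφ.aestronglyMeasurable]

lemma integral_sub (hW : IsStandardBrownianMotion P ℱ W) {s t : ℝ} (hs : 0 ≤ s)
    (hst : s ≤ t) : ∫ ω, (W t ω - W s ω) ∂P = 0 := by
  rw [hW.integral_comp_sub hs hst (φ := fun y => y) measurable_id, integral_id_gaussianReal]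

lemma integral_sub_sq (hW : IsStandardBrownianMotion P ℱ W) {s t : ℝ} (hs : 0 ≤ s)
    (hst : s ≤ t) : ∫ ω, (W t ω - W s ω) ^ 2 ∂P = t - s := by
  rw [hW.integral_comp_sub hs hst (φ := fun y => y ^ 2) (by fun_prop), integral_sq_gaussianReal,
    Real.coe_toNNReal _ (sub_nonneg.2 hst)]

lemma integral_sub_pow_four (hW : IsStandardBrownianMotion P ℱ W) {s t : ℝ} (hs : 0 ≤ s)
    (hst : s ≤ t) : ∫ ω, (W t ω - W s ω) ^ 4 ∂P
      = (∫ y, y ^ 4 ∂gaussianReal 0 1) * (t - s) ^ 2 := by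
  rw [hW.integral_comp_sub hs hst (φ := fun y => y ^ 4) (by fun_prop),
    integral_pow_four_gaussianReal, Real.coe_toNNReal _ (sub_nonneg.2 hst)]

lemma indepFun (hW : IsStandardBrownianMotion P ℱ W) {s t : ℝ} (hs : 0 ≤ s)
    (hst : s ≤ t) {ξ : Ω → ℝ} (hξ : Measurable[ℱ s] ξ) {φ : ℝ → ℝ} (hφ : Measurable φ) :
    IndepFun ξ (fun ω => φ (W t ω - W s ω)) P := by
  have h1 : IndepFun (fun ω => W t ω - W s ω) ξ P := by
    rw [IndepFun_iff_Indep]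
    exact indep_of_indep_of_le_right (hW.2.2.2.1 s t hs hst) hξ.comap_le
  exact h1.symm.comp (φ := id) measurable_id hφ

lemma integrable_mul_sub (hW : IsStandardBrownianMotion P ℱ W) {s t : ℝ} (hs : 0 ≤ s)
    (hst : s ≤ t) {ξ : Ω → ℝ} (hξ : Measurable[ℱ s] ξ) (hi : Integrable ξ P) :
    Integrable (fun ω => ξ ω * (W t ω - W s ω)) P :=
  (hW.indepFun hs hst hξ (φ := fun y => y) measurable_id).integrable_mul hi
    (by simpa using hW.integrable_sub_pow hs hst 1)

lemma integral_mul_sub (hW : IsStandardBrownianMotion P ℱ W) {s t : ℝ} (hs : 0 ≤ s)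
    (hst : s ≤ t) {ξ : Ω → ℝ} (hξ : Measurable[ℱ s] ξ) :
    ∫ ω, ξ ω * (W t ω - W s ω) ∂P = 0 := by
  have h := (hW.indepFun hs hst hξ (φ := fun y => y) measurable_id).integral_mul_eq_mul_integral
    (hξ.mono (ℱ.le s) le_rfl).aestronglyMeasurable (hW.measurable_sub s t).aestronglyMeasurable
  rw [hW.integral_sub hs hst, mul_zero] at h
  exact h

lemma integrable_mul_sub_sq (hW : IsStandardBrownianMotion P ℱ W) [IsFiniteMeasure P]
    {s t : ℝ} (hs : 0 ≤ s)
    (hst : s ≤ t) {ξ : Ω → ℝ} (hξ : Measurable[ℱ s] ξ) (hi : Integrable ξ P) :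
    Integrable (fun ω => ξ ω * ((W t ω - W s ω) ^ 2 - (t - s))) P :=
  (hW.indepFun hs hst hξ (φ := fun y => y ^ 2 - (t - s)) (by fun_prop)).integrable_mul hi
    ((hW.integrable_sub_pow hs hst 2).sub (integrable_const _))

lemma integral_mul_sub_sq (hW : IsStandardBrownianMotion P ℱ W) [IsProbabilityMeasure P]
    {s t : ℝ} (hs : 0 ≤ s) (hst : s ≤ t) {ξ : Ω → ℝ} (hξ : Measurable[ℱ s] ξ) :
    ∫ ω, ξ ω * ((W t ω - W s ω) ^ 2 - (t - s)) ∂P = 0 := by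
  have h := (hW.indepFun hs hst hξ (φ := fun y => y ^ 2 - (t - s))
    (by fun_prop)).integral_mul_eq_mul_integral
    (hξ.mono (ℱ.le s) le_rfl).aestronglyMeasurable
    (((hW.measurable_sub s t).pow_const 2).sub_const _).aestronglyMeasurable
  rw [MeasureTheory.integral_sub (hW.integrable_sub_pow hs hst 2) (integrable_const _),
    hW.integral_sub_sq hs hst] at h
  simpa using h

lemma measurable_partialSups {Z : ℝ → Ω → ℝ} (hZ : Adapted ℱ Z) {h : ℝ} (hh : 0 ≤ h) (n : ℕ) :
    Measurable[ℱ (n * h)] fun ω => partialSups (fun j : ℕ => Z (j * h) ω) n := by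
  induction n with
  | zero =>
    simp only [partialSups_zero]
    exact hZ _
  | succ n ih =>
    simp only [partialSups_add_one]
    refine Measurable.sup (ih.mono (ℱ.mono ?_) le_rfl) (hZ _)
    push_cast
    nlinarith

/-- A trajectorial form of Doob's maximal inequality. -/
lemma partialSups_sq_le (w : ℕ → ℝ) (h0 : w 0 = 0) (n : ℕ) :
    partialSups w n ^ 2 ≤ 2 * partialSups w n * w n
      - 2 * ∑ i ∈ Finset.range n, partialSups w i * (w (i + 1) - w i) := by
  induction n with
  | zero => simp [h0]
  | succ n ih =>
    rw [Finset.sum_range_succ, partialSups_add_one]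
    set s := partialSups w n
    have h1 : (s ⊔ w (n + 1)) ^ 2 - s ^ 2 ≤ 2 * (s ⊔ w (n + 1) - s) * w (n + 1) := by
      rcases le_total (w (n + 1)) s with h | h
      · simp [sup_eq_left.2 h]
      · rw [sup_eq_right.2 h]; nlinarith
    nlinarith

lemma memLp_two (hW : IsStandardBrownianMotion P ℱ W) {t : ℝ} (ht : 0 ≤ t) :
    MemLp (W t) 2 P := by
  rw [memLp_two_iff_integrable_sq (hW.measurable t).aestronglyMeasurable]
  simpa [hW.2.1] using hW.integrable_sub_pow le_rfl ht 2

lemma memLp_partialSups (hW : IsStandardBrownianMotion P ℱ W) {h : ℝ} (hh : 0 ≤ h) (n : ℕ) :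
    MemLp (fun ω => partialSups (fun j : ℕ => W (j * h) ω) n) 2 P := by
  induction n with
  | zero => simpa using hW.memLp_two le_rfl
  | succ n ih =>
    simp only [partialSups_add_one]
    exact ih.sup (hW.memLp_two (by positivity))

lemma integral_partialSups_sq_le (hW : IsStandardBrownianMotion P ℱ W) [IsProbabilityMeasure P]
    {h : ℝ} (hh : 0 ≤ h) (n : ℕ) :
    ∫ ω, partialSups (fun j : ℕ => W (j * h) ω) n ^ 2 ∂P ≤ 4 * (n * h) := by
  set S : ℕ → Ω → ℝ := fun n ω => partialSups (fun j : ℕ => W (j * h) ω) n with hS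
  have hle : ∀ i : ℕ, (i : ℝ) * h ≤ ((i + 1 : ℕ) : ℝ) * h := fun i => by push_cast; nlinarith
  have hmart : ∀ i : ℕ, Integrable (fun ω => S i ω * (W ((i + 1 : ℕ) * h) ω - W (i * h) ω)) P :=
    fun i => hW.integrable_mul_sub (by positivity) (hle i)
      (measurable_partialSups hW.2.2.1 hh i) ((hW.memLp_partialSups hh i).integrable (by simp))
  have hS2 := (hW.memLp_partialSups hh n).integrable_sq
  have hW2 := (hW.memLp_two (t := n * h) (by positivity)).integrable_sq
  have h12 : Integrable (fun ω => S n ω ^ 2 / 2 + 2 * W (n * h) ω ^ 2) P :=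
    (hS2.div_const 2).add (hW2.const_mul 2)
  have hmono : ∫ ω, S n ω ^ 2 ∂P ≤ ∫ ω, (S n ω ^ 2 / 2 + 2 * W (n * h) ω ^ 2
      - 2 * ∑ i ∈ Finset.range n, S i ω * (W ((i + 1 : ℕ) * h) ω - W (i * h) ω)) ∂P := by
    refine integral_mono hS2 (h12.sub
      ((integrable_finsetSum _ fun i _ => hmart i).const_mul 2)) fun ω => ?_
    have h1 := partialSups_sq_le (fun j : ℕ => W (j * h) ω) (by simp [hW.2.1]) n
    have h2 := sq_nonneg (S n ω - 2 * W (n * h) ω)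
    simp only [hS] at h2 ⊢
    nlinarith
  have hWsq : ∫ ω, W (n * h) ω ^ 2 ∂P = n * h := by
    simpa [hW.2.1] using hW.integral_sub_sq le_rfl (by positivity : 0 ≤ n * h)
  rw [MeasureTheory.integral_sub h12
      ((integrable_finsetSum _ fun i _ => hmart i).const_mul 2),
    integral_add (hS2.div_const 2) (hW2.const_mul 2), integral_div, integral_const_mul,
    integral_const_mul, integral_finsetSum _ fun i _ => hmart i, hWsq,
    Finset.sum_eq_zero fun i _ => hW.integral_mul_sub (by positivity) (hle i)
      (measurable_partialSups hW.2.2.1 hh i)] at hmono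
  change ∫ ω, S n ω ^ 2 ∂P ≤ _
  linarith

end IsStandardBrownianMotion

/-- The running maximum of a path on `[0, |t|]`. -/
noncomputable def pathMax (z : ℝ → ℝ) (t : ℝ) : ℝ := sSup (z '' Icc 0 |t|)

section PathMax

variable {z : ℝ → ℝ}

lemma pathMax_of_nonneg (z : ℝ → ℝ) {t : ℝ} (ht : 0 ≤ t) : pathMax z t = sSup (z '' Icc 0 t) := by
  rw [pathMax, abs_of_nonneg ht]

lemma le_pathMax (hz : Continuous z) {u t : ℝ} (hu : 0 ≤ u) (hut : u ≤ t) : z u ≤ pathMax z t := by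
  rw [pathMax_of_nonneg z (hu.trans hut)]
  exact le_csSup (isCompact_Icc.bddAbove_image hz.continuousOn) ⟨u, ⟨hu, hut⟩, rfl⟩

lemma pathMax_le {t a : ℝ} (ht : 0 ≤ t) (h : ∀ u ∈ Icc 0 t, z u ≤ a) : pathMax z t ≤ a := by
  rw [pathMax_of_nonneg z ht]
  refine csSup_le ⟨z 0, 0, ⟨le_rfl, ht⟩, rfl⟩ ?_
  rintro _ ⟨u, hu, rfl⟩
  exact h u hu

lemma pathMax_zero (z : ℝ → ℝ) : pathMax z 0 = z 0 := by simp [pathMax]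

lemma pathMax_abs (z : ℝ → ℝ) (t : ℝ) : pathMax z |t| = pathMax z t := by simp [pathMax]

lemma continuous_pathMax (hz : Continuous z) : Continuous (pathMax z) := by
  have h : pathMax z = fun t => sSup ((fun r => z (r * |t|)) '' Icc 0 1) := by
    ext t
    rw [pathMax]
    congr 1
    rw [← image_image z fun r => r * |t|, image_mul_right_Icc zero_le_one (abs_nonneg t)]
    simp
  rw [h]
  refine isCompact_Icc.continuous_sSup (f := fun t r => z (r * |t|)) ?_
  change Continuous fun q : ℝ × ℝ => z (q.2 * |q.1|)
  fun_prop

lemma partialSups_grid_le_pathMax (hz : Continuous z) {h s : ℝ} (hh : 0 ≤ h) {i : ℕ}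
    (hs : i * h ≤ s) : partialSups (fun j : ℕ => z (j * h)) i ≤ pathMax z s :=
  partialSups_le _ _ _ fun j hj => le_pathMax hz (by positivity)
    (le_trans (mul_le_mul_of_nonneg_right (by exact_mod_cast hj) hh) hs)

lemma pathMax_sub_partialSups_grid_le {h T ε s : ℝ} (hh : 0 < h)
    (hosc : ∀ u ∈ Icc 0 T, ∀ v ∈ Icc 0 T, |u - v| ≤ h → |z u - z v| ≤ ε) {i : ℕ}
    (his : i * h ≤ s) (hsi : s ≤ (i + 1) * h) (hsT : s ≤ T) :
    pathMax z s - partialSups (fun j : ℕ => z (j * h)) i ≤ ε := by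
  have hs : 0 ≤ s := le_trans (by positivity) his
  rw [sub_le_iff_le_add']
  refine pathMax_le hs fun u hu => ?_
  have hfl : (⌊u / h⌋₊ : ℝ) * h ≤ u := by
    rw [← le_div_iff₀ hh]
    exact Nat.floor_le (div_nonneg hu.1 hh.le)
  have hlt : u < (⌊u / h⌋₊ + 1) * h := by
    rw [← div_lt_iff₀ hh]
    exact Nat.lt_floor_add_one _
  obtain ⟨j, hji, hju, huj⟩ : ∃ j : ℕ, j ≤ i ∧ j * h ≤ u ∧ u ≤ (j + 1) * h := by
    rcases le_total ⌊u / h⌋₊ i with hle | hle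
    · exact ⟨_, hle, hfl, hlt.le⟩
    · refine ⟨i, le_rfl, le_trans ?_ hfl, hu.2.trans hsi⟩
      exact mul_le_mul_of_nonneg_right (by exact_mod_cast hle) hh.le
  have h1 := hosc u ⟨hu.1, hu.2.trans hsT⟩ (j * h)
    ⟨by positivity, hju.trans (hu.2.trans hsT)⟩ (by
      rw [abs_of_nonneg (sub_nonneg.2 hju)]; linarith)
  have h2 := le_partialSups_of_le (fun j : ℕ => z (j * h)) hji
  have h3 := le_abs_self (z u - z (j * h))
  linarith

lemma eventually_abs_sub_le_of_grid (hz : Continuous z) (T : ℝ) {ε : ℝ} (hε : 0 < ε) :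
    ∀ᶠ n : ℕ in Filter.atTop, ∀ u ∈ Icc 0 T, ∀ v ∈ Icc 0 T, |u - v| ≤ T / n →
      |z u - z v| ≤ ε := by
  have h := (isCompact_Icc (a := (0 : ℝ)) (b := T)).uniformContinuousOn_of_continuous
    hz.continuousOn
  obtain ⟨δ, hδ, h⟩ := Metric.uniformContinuousOn_iff.1 h ε hε
  filter_upwards [(tendsto_const_div_atTop_nhds_zero_nat T).eventually (gt_mem_nhds hδ)]
    with n hn u hu v hv huv
  exact (h u hu v hv (huv.trans_lt hn)).le

lemma tendsto_partialSups_grid (hz : Continuous z) {T : ℝ} (hT : 0 < T) :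
    Filter.Tendsto (fun n : ℕ => partialSups (fun j : ℕ => z (j * (T / n))) n) Filter.atTop
      (nhds (pathMax z T)) := by
  rw [Metric.tendsto_atTop']
  intro ε hε
  have h := (eventually_abs_sub_le_of_grid hz T (half_pos hε)).and (Filter.eventually_gt_atTop 0)
  obtain ⟨N, hN⟩ := Filter.eventually_atTop.1 h
  refine ⟨N, fun n hn => ?_⟩
  obtain ⟨hosc, hn0⟩ := hN n hn.le
  have hn0' : (0 : ℝ) < n := by exact_mod_cast hn0
  have hnT : n * (T / n) = T := by field_simp
  have hh : 0 < T / n := by positivity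
  have h1 := partialSups_grid_le_pathMax hz hh.le hnT.le
  have h2 := pathMax_sub_partialSups_grid_le hh hosc hnT.le (by rw [add_mul, hnT]; linarith) le_rfl
  rw [Real.dist_eq, abs_sub_comm, abs_of_nonneg (sub_nonneg.2 h1)]
  linarith

end PathMax

lemma measurable_pathMax {Ω : Type*} {m : MeasurableSpace Ω} {Z : ℝ → Ω → ℝ}
    (hc : ∀ ω, Continuous fun t => Z t ω) (hm : ∀ t, Measurable (Z t)) (t : ℝ) :
    Measurable fun ω => pathMax (fun s => Z s ω) t := by
  rcases eq_or_ne t 0 with rfl | ht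
  · simpa only [pathMax_zero] using hm 0
  have hsup : ∀ (h : ℝ) (n : ℕ),
      Measurable fun ω => partialSups (fun j : ℕ => Z (j * h) ω) n := by
    intro h n
    induction n with
    | zero => simpa only [partialSups_zero] using hm _
    | succ n ih =>
      simp only [partialSups_add_one]
      exact ih.sup (hm _)
  refine measurable_of_tendsto_metrizable
    (f := fun (n : ℕ) ω => partialSups (fun j : ℕ => Z (j * (|t| / n)) ω) n)
    (fun n => hsup _ n) ?_
  rw [tendsto_pi_nhds]
  intro ω
  rw [← pathMax_abs]
  exact tendsto_partialSups_grid (hc ω) (abs_pos.2 ht)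

lemma IsStandardBrownianMotion.integrable_pathMax {Ω : Type*} {m : MeasurableSpace Ω}
    {P : Measure Ω} [IsProbabilityMeasure P] {ℱ : Filtration ℝ m} {W : ℝ → Ω → ℝ}
    (hW : IsStandardBrownianMotion P ℱ W) {T : ℝ} (hT : 0 < T) :
    Integrable (fun ω => pathMax (fun t => W t ω) T) P := by
  set F : ℕ → Ω → ℝ := fun n ω => partialSups (fun j : ℕ => W (j * (T / n)) ω) n with hF
  have hmem : ∀ n : ℕ, MemLp (F n) 2 P := fun n => hW.memLp_partialSups (by positivity) n
  have hlim : ∀ ω, Filter.Tendsto (fun n => F n ω) Filter.atTop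
      (nhds (pathMax (fun t => W t ω) T)) := fun ω => tendsto_partialSups_grid (hW.continuous ω) hT
  refine ⟨(measurable_pathMax hW.continuous hW.measurable T).aestronglyMeasurable, ?_⟩
  refine lt_of_le_of_lt ?_ (ENNReal.ofReal_lt_top (r := 1 + 4 * T))
  rw [lintegral_congr fun ω => ((hlim ω).enorm.liminf_eq).symm]
  refine (lintegral_liminf_le' fun n => (hmem n).aestronglyMeasurable.aemeasurable.enorm).trans ?_
  refine Filter.liminf_le_of_frequently_le' (Filter.Eventually.frequently ?_)
  filter_upwards [Filter.eventually_gt_atTop 0] with n hn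
  have hn' : (n : ℝ) ≠ 0 := by exact_mod_cast hn.ne'
  rw [← ofReal_integral_norm_eq_lintegral_enorm ((hmem n).integrable (by simp))]
  refine ENNReal.ofReal_le_ofReal ?_
  calc ∫ ω, ‖F n ω‖ ∂P ≤ ∫ ω, (1 + F n ω ^ 2) ∂P := by
        refine integral_mono ((hmem n).integrable (by simp)).norm
          ((integrable_const _).add (hmem n).integrable_sq) fun ω => ?_
        simp only [Real.norm_eq_abs]
        nlinarith [sq_nonneg (|F n ω| - 1), sq_abs (F n ω)]
    _ = 1 + ∫ ω, F n ω ^ 2 ∂P := by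
        rw [integral_add (integrable_const _) (hmem n).integrable_sq]
        simp
    _ ≤ 1 + 4 * T := by
        have := hW.integral_partialSups_sq_le (h := T / n) (by positivity) n
        rw [mul_div_cancel₀ _ hn'] at this
        gcongr

/-- The constant in the error term of the discrete Itô formula for `maxHarmonic`. -/
noncomputable def stepConst (C S L' L'' : ℝ) : ℝ :=
  8 * L'' * (1 + C ^ 4) + 8 * L' * (1 + C ^ 3) + C * Real.exp (4 * C * S) * (C + C ^ 2)

/-- The size of the error in one step of length `κ ^ 4` with Gaussian increment `w`. -/
noncomputable def stepError (κ w : ℝ) : ℝ := κ ^ 6 + κ ^ 2 * w ^ 2 + w ^ 4 / κ ^ 2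

namespace IsStripBounded

variable {C S L L' L'' : ℝ} {f : ℝ → ℝ → ℝ}

lemma maxHarmonic_step_le (hf : IsStripBounded C S f) (hS : 0 ≤ S)
    (hL : IsPlaneLipschitz L f) (hL'' : IsPlaneLipschitz L'' (scaleDensity f))
    (hL' : IsPlaneLipschitz L' fun u m => f u m * scaleDensity f u m)
    {σ κ : ℝ} (hσ : |σ| ≤ 1) (hκ : 0 < κ) (hκ1 : κ ≤ 1) (x : ℝ) {z m w a : ℝ} (hzm : z ≤ m)
    (ha : |a| ≤ C * κ ^ 4) :
    σ * (maxHarmonic f x (z + (w + a)) (max m (z + (w + a))) - maxHarmonic f x z m)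
      ≤ scaleDensity f z m * (σ * a) - σ * (f z m * scaleDensity f z m * κ ^ 4)
        + (σ * (scaleDensity f z m * w)
          - σ * (f z m * scaleDensity f z m * (w ^ 2 - κ ^ 4)))
        + L'' * κ * (max m (z + (w + a)) - m) + stepConst C S L' L'' * stepError κ w := by
  have hC := hf.nonneg
  have h0 := hf.abs_maxHarmonic_step_le hS hL hL'' hL' x z (w + a) m
  set p := scaleDensity f z m with hp
  set δ := w + a with hδ
  set d := max m (z + δ) - m with hd
  set B := Real.exp (4 * C * S) with hB
  set H := maxHarmonic f x (z + δ) (max m (z + δ)) - maxHarmonic f x z m with hH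
  have hE1 : κ ^ 6 ≤ stepError κ w := by
    have : 0 ≤ κ ^ 2 * w ^ 2 + w ^ 4 / κ ^ 2 := by positivity
    rw [stepError]; linarith
  have hE2 : κ ^ 6 + κ ^ 2 * w ^ 2 ≤ stepError κ w := by
    have : 0 ≤ w ^ 4 / κ ^ 2 := by positivity
    rw [stepError]; linarith
  have hE3 : w ^ 4 / κ ^ 2 + κ ^ 2 * w ^ 2 ≤ stepError κ w := by
    have : 0 ≤ κ ^ 6 := by positivity
    rw [stepError]; linarith
  have hE4 : w ^ 4 / κ ^ 2 ≤ stepError κ w := by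
    have : 0 ≤ κ ^ 2 * w ^ 2 := by positivity
    linarith
  have hE0 : 0 ≤ stepError κ w := le_trans (by positivity) hE1
  set E := stepError κ w with hE
  have hδabs : |δ| ≤ |w| + C * κ ^ 4 := (abs_add_le w a).trans (by linarith)
  have hc : 0 ≤ C * κ ^ 4 := by positivity
  have hd0 : 0 ≤ d := sub_nonneg.2 (le_max_left _ _)
  have hdδ : d ≤ |δ| := by
    rw [hd, sub_le_iff_le_add]
    refine max_le (by linarith [abs_nonneg δ]) ?_
    linarith [le_abs_self δ]
  have hpow : ∀ k, 6 ≤ k → κ ^ k ≤ κ ^ 6 := fun k hk => pow_le_pow_of_le_one hκ.le hκ1 hk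
  have hd2 : d ^ 2 ≤ κ * d + 8 * (1 + C ^ 4) * E := by
    have h1 : d ^ 2 ≤ κ * d + d ^ 4 / κ ^ 2 := by
      rcases le_total d κ with h | h
      · have : 0 ≤ d ^ 4 / κ ^ 2 := by positivity
        nlinarith
      · have : d ^ 2 ≤ d ^ 4 / κ ^ 2 := by
          rw [le_div_iff₀ (by positivity)]
          have := pow_le_pow_left₀ hκ.le h 2
          nlinarith [sq_nonneg d]
        have : 0 ≤ κ * d := by positivity
        linarith
    have h2 : d ^ 4 ≤ 8 * (w ^ 4 + (C * κ ^ 4) ^ 4) := by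
      calc d ^ 4 ≤ (|w| + C * κ ^ 4) ^ 4 := pow_le_pow_left₀ hd0 (hdδ.trans hδabs) 4
        _ ≤ 2 ^ (4 - 1) * (|w| ^ 4 + (C * κ ^ 4) ^ 4) := add_pow_le (abs_nonneg _) hc 4
        _ = 8 * (w ^ 4 + (C * κ ^ 4) ^ 4) := by
          rw [show |w| ^ 4 = w ^ 4 from (by decide : Even 4).pow_abs w]; norm_num
    have h3 : d ^ 4 / κ ^ 2 ≤ 8 * (w ^ 4 / κ ^ 2) + 8 * C ^ 4 * κ ^ 14 := by
      rw [div_le_iff₀ (by positivity)]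
      refine h2.trans_eq ?_
      field_simp
    have h4 : C ^ 4 * κ ^ 14 ≤ C ^ 4 * E :=
      mul_le_mul_of_nonneg_left ((hpow 14 (by norm_num)).trans hE1) (by positivity)
    linarith
  have hδ3 : |δ| ^ 3 ≤ 4 * (1 + C ^ 3) * E := by
    have h2 : |δ| ^ 3 ≤ 4 * (|w| ^ 3 + (C * κ ^ 4) ^ 3) := by
      calc |δ| ^ 3 ≤ (|w| + C * κ ^ 4) ^ 3 := pow_le_pow_left₀ (abs_nonneg _) hδabs 3
        _ ≤ 2 ^ (3 - 1) * (|w| ^ 3 + (C * κ ^ 4) ^ 3) := add_pow_le (abs_nonneg _) hc 3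
        _ = _ := by norm_num
    have h3 : |w| ^ 3 ≤ w ^ 4 / κ ^ 2 + κ ^ 2 * w ^ 2 := by
      have h4 : |w| ≤ w ^ 2 / κ ^ 2 + κ ^ 2 := by
        have : 0 ≤ (|w| / κ - κ) ^ 2 := sq_nonneg _
        have h5 : (|w| / κ - κ) ^ 2 = w ^ 2 / κ ^ 2 - 2 * |w| + κ ^ 2 := by
          rw [← sq_abs w]
          field_simp
          ring
        linarith [abs_nonneg w]
      have h5 := mul_le_mul_of_nonneg_left h4 (sq_nonneg w)
      calc |w| ^ 3 = w ^ 2 * |w| := by rw [← sq_abs w]; ring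
        _ ≤ _ := h5
        _ = _ := by ring
    have h4 : C ^ 3 * κ ^ 12 ≤ C ^ 3 * E :=
      mul_le_mul_of_nonneg_left ((hpow 12 (by norm_num)).trans hE1) (by positivity)
    have h5 : (C * κ ^ 4) ^ 3 = C ^ 3 * κ ^ 12 := by ring
    linarith
  have hcross : |2 * w * a + a ^ 2| ≤ (C + C ^ 2) * E := by
    have h1 : |2 * w * a + a ^ 2| ≤ 2 * |w| * |a| + |a| ^ 2 := by
      refine (abs_add_le _ _).trans_eq ?_
      rw [abs_mul, abs_mul, abs_pow]; norm_num
    have h2 : 2 * |w| * |a| ≤ C * (κ ^ 6 + κ ^ 2 * w ^ 2) := by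
      calc 2 * |w| * |a| ≤ 2 * |w| * (C * κ ^ 4) := by gcongr
        _ = C * κ ^ 2 * (2 * |w| * κ ^ 2) := by ring
        _ ≤ C * κ ^ 2 * (κ ^ 4 + w ^ 2) := by
          gcongr
          rw [← sq_abs w]
          nlinarith [sq_nonneg (|w| - κ ^ 2)]
        _ = _ := by ring
    have h3 : |a| ^ 2 ≤ C ^ 2 * κ ^ 8 := by
      refine (pow_le_pow_left₀ (abs_nonneg _) ha 2).trans_eq (by ring)
    have h4 : C ^ 2 * κ ^ 8 ≤ C ^ 2 * E :=
      mul_le_mul_of_nonneg_left ((hpow 8 (by norm_num)).trans hE1) (by positivity)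
    have h5 := mul_le_mul_of_nonneg_left hE2 hC
    linarith
  have hfp : |f z m * p| ≤ C * B := by
    rw [abs_mul, abs_of_pos (scaleDensity_pos f z m)]
    exact mul_le_mul (hf.bdd z m) (hf.scaleDensity_le hS z m) (scaleDensity_pos f z m).le hC
  have hcross' : |f z m * p * (2 * w * a + a ^ 2)| ≤ C * B * ((C + C ^ 2) * E) := by
    rw [abs_mul]
    exact mul_le_mul hfp hcross (abs_nonneg _) (by positivity)
  have hrem : |H - (p * δ - f z m * p * δ ^ 2)|
      ≤ L'' * κ * d + 8 * L'' * (1 + C ^ 4) * E + 8 * L' * (1 + C ^ 3) * E := by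
    refine h0.trans ?_
    have h1 := mul_le_mul_of_nonneg_left hd2 hL''.nonneg
    have h2 := mul_le_mul_of_nonneg_left hδ3 (mul_nonneg zero_le_two hL'.nonneg)
    linarith
  have hσmul : ∀ y : ℝ, σ * y ≤ |y| := fun y => by
    refine (le_abs_self _).trans ?_
    rw [abs_mul]
    exact mul_le_of_le_one_left (abs_nonneg _) hσ
  have h1 := (hσmul (H - (p * δ - f z m * p * δ ^ 2))).trans hrem
  have h2 := (hσmul (-(f z m * p * (2 * w * a + a ^ 2)))).trans ((abs_neg _).trans_le hcross')
  have h3 : δ ^ 2 = w ^ 2 + (2 * w * a + a ^ 2) := by rw [hδ]; ring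
  rw [h3] at h1
  have h4 : stepConst C S L' L'' * E = 8 * L'' * (1 + C ^ 4) * E + 8 * L' * (1 + C ^ 3) * E
    + C * B * ((C + C ^ 2) * E) := by rw [stepConst]; ring
  rw [h4]
  rw [hδ] at h1
  linarith

lemma maxHarmonic_sum_le (hf : IsStripBounded C S f) (hS : 0 ≤ S)
    (hL : IsPlaneLipschitz L f) (hL'' : IsPlaneLipschitz L'' (scaleDensity f))
    (hL' : IsPlaneLipschitz L' fun u m => f u m * scaleDensity f u m)
    {σ κ : ℝ} (hσ : |σ| ≤ 1) (hκ : 0 < κ) (hκ1 : κ ≤ 1) {x : ℝ} {z w a I : ℕ → ℝ}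
    (n : ℕ) (hz0 : z 0 = x) (hz : ∀ i < n, z (i + 1) = z i + (w i + a i))
    (ha : ∀ i < n, |a i| ≤ C * κ ^ 4) (hI : ∀ i < n, σ * a i ≤ σ * I i) :
    σ * maxHarmonic f x (z n) (partialSups z n)
        - ∑ i ∈ Finset.range n, σ * (scaleDensity f (z i) (partialSups z i) * I i
          - f (z i) (partialSups z i) * scaleDensity f (z i) (partialSups z i) * κ ^ 4)
      ≤ ∑ i ∈ Finset.range n, (σ * (scaleDensity f (z i) (partialSups z i) * w i)
          - σ * (f (z i) (partialSups z i) * scaleDensity f (z i) (partialSups z i)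
            * (w i ^ 2 - κ ^ 4)))
        + L'' * κ * (partialSups z n - x)
        + stepConst C S L' L'' * ∑ i ∈ Finset.range n, stepError κ (w i) := by
  induction n with
  | zero => simp [hz0, maxHarmonic_self]
  | succ n ih =>
    have h1 := ih (fun i hi => hz i (by omega)) (fun i hi => ha i (by omega))
      (fun i hi => hI i (by omega))
    have h2 := hf.maxHarmonic_step_le hS hL hL'' hL' hσ hκ hκ1 x (w := w n)
      (le_partialSups z n) (ha n (by omega))
    have h3 := mul_le_mul_of_nonneg_left (hI n (by omega))
      (scaleDensity_pos f (z n) (partialSups z n)).le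
    simp only [Finset.sum_range_succ]
    have h4 : partialSups z (n + 1) = max (partialSups z n) (z n + (w n + a n)) := by
      rw [partialSups_add_one, hz n (by omega)]
    rw [← hz n (by omega), ← partialSups_add_one] at h2
    linarith

end IsStripBounded

lemma abs_grid_sum_sub_integral_le {z G : ℝ → ℝ} {φ : ℝ → ℝ → ℝ} {L C T h ε : ℝ} {n : ℕ}
    (hz : Continuous z) (hφ : IsPlaneLipschitz L φ) (hG : Measurable G)
    (hGC : ∀ s, |G s| ≤ C) (hh : 0 < h) (hnh : n * h = T)
    (hosc : ∀ u ∈ Icc 0 T, ∀ v ∈ Icc 0 T, |u - v| ≤ h → |z u - z v| ≤ ε) :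
    |∑ i ∈ Finset.range n, φ (z (i * h)) (partialSups (fun j : ℕ => z (j * h)) i)
          * (∫ s in (i * h : ℝ)..((i + 1 : ℕ) * h : ℝ), G s)
        - ∫ s in (0 : ℝ)..T, φ (z s) (pathMax z s) * G s| ≤ T * (L * (2 * ε) * C) := by
  have hGi : ∀ a b, IntervalIntegrable G volume a b := fun a b =>
    (intervalIntegrable_const (c := C)).mono_fun hG.aestronglyMeasurable
      (ae_of_all _ fun s => by
        simp only [Real.norm_eq_abs]
        exact (hGC s).trans (le_abs_self C))
  have hφc : Continuous fun s => φ (z s) (pathMax z s) :=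
    hφ.continuous.comp (hz.prodMk (continuous_pathMax hz))
  have hφG : ∀ a b, IntervalIntegrable (fun s => φ (z s) (pathMax z s) * G s) volume a b :=
    fun a b => (hGi a b).continuousOn_mul hφc.continuousOn
  have hsum := intervalIntegral.sum_integral_adjacent_intervals (a := fun i : ℕ => (i : ℝ) * h)
    (n := n) (fun k _ => hφG _ _)
  simp only [Nat.cast_zero, zero_mul, hnh] at hsum
  rw [← hsum, ← Finset.sum_sub_distrib]
  refine (Finset.abs_sum_le_sum_abs _ _).trans ?_
  calc _ ≤ ∑ i ∈ Finset.range n, L * (2 * ε) * C * h := ?_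
    _ = T * (L * (2 * ε) * C) := by
      rw [Finset.sum_const, Finset.card_range, nsmul_eq_mul, ← hnh]; ring
  refine Finset.sum_le_sum fun i hi => ?_
  have hi' : (i : ℝ) + 1 ≤ n := by exact_mod_cast Finset.mem_range.1 hi
  rw [← intervalIntegral.integral_const_mul,
    ← intervalIntegral.integral_sub ((hGi _ _).const_mul _) (hφG _ _)]
  have hle : (i : ℝ) * h ≤ (i + 1 : ℕ) * h := by push_cast; nlinarith
  have := intervalIntegral.norm_integral_le_of_norm_le_const (a := (i : ℝ) * h)
    (b := ((i + 1 : ℕ) : ℝ) * h) (C := L * (2 * ε) * C)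
    (f := fun s => φ (z (i * h)) (partialSups (fun j : ℕ => z (j * h)) i) * G s
      - φ (z s) (pathMax z s) * G s) (fun s hs => by
      rw [uIoc_of_le hle] at hs
      push_cast at hs
      have hi0 : 0 ≤ (i : ℝ) * h := by positivity
      have hsT : s ≤ T := hs.2.trans (by rw [← hnh]; gcongr)
      rw [← sub_mul, norm_mul, Real.norm_eq_abs, Real.norm_eq_abs]
      refine mul_le_mul ?_ (hGC s) (abs_nonneg _)
        (mul_nonneg hφ.nonneg (mul_nonneg zero_le_two ?_))
      · refine (hφ _ _ _ _).trans (mul_le_mul_of_nonneg_left ?_ hφ.nonneg)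
        have h1 := hosc (i * h) ⟨hi0, hs.1.le.trans hsT⟩ s ⟨hi0.trans hs.1.le, hsT⟩ (by
          rw [abs_sub_comm, abs_of_nonneg (sub_nonneg.2 hs.1.le)]; linarith [hs.2])
        have h2 := pathMax_sub_partialSups_grid_le hh hosc hs.1.le hs.2 hsT
        have h3 := partialSups_grid_le_pathMax hz hh.le hs.1.le
        rw [abs_sub_comm (partialSups _ _), abs_of_nonneg (sub_nonneg.2 h3)]
        linarith
      · have h1 := hosc 0 ⟨le_rfl, hi0.trans (hs.1.le.trans hsT)⟩ 0
          ⟨le_rfl, hi0.trans (hs.1.le.trans hsT)⟩ (by simpa using hh.le)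
        simpa using h1)
  rw [Real.norm_eq_abs, abs_of_nonneg (sub_nonneg.2 hle)] at this
  refine this.trans_eq ?_
  push_cast
  ring

lemma tendsto_grid_sum {z G : ℝ → ℝ} {φ : ℝ → ℝ → ℝ} {L C T : ℝ}
    (hz : Continuous z) (hφ : IsPlaneLipschitz L φ) (hG : Measurable G)
    (hGC : ∀ s, |G s| ≤ C) (hT : 0 < T) :
    Filter.Tendsto (fun n : ℕ => ∑ i ∈ Finset.range n,
      φ (z (i * (T / n))) (partialSups (fun j : ℕ => z (j * (T / n))) i)
          * (∫ s in (i * (T / n) : ℝ)..((i + 1 : ℕ) * (T / n) : ℝ), G s)) Filter.atTop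
      (nhds (∫ s in (0 : ℝ)..T, φ (z s) (pathMax z s) * G s)) := by
  rw [Metric.tendsto_nhds]
  intro ε hε
  have hC : 0 ≤ C := (abs_nonneg _).trans (hGC 0)
  have hL := hφ.nonneg
  set η := ε / (2 * T * L * C + 1) with hη
  have hη0 : 0 < η := by positivity
  filter_upwards [eventually_abs_sub_le_of_grid hz T hη0, Filter.eventually_gt_atTop 0]
    with n hn hn0
  have hn0' : (0 : ℝ) < n := by exact_mod_cast hn0
  rw [Real.dist_eq]
  refine (abs_grid_sum_sub_integral_le hz hφ hG hGC (by positivity) (by field_simp) hn).trans_lt ?_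
  have h1 : (2 * T * L * C + 1) * η = ε := by rw [hη]; field_simp
  nlinarith

/-- A Brownian motion started at `x` plus an adapted drift whose paths are `C`-Lipschitz. -/
structure IsDriftedBrownian {Ω : Type*} {m : MeasurableSpace Ω} (P : Measure Ω)
    (ℱ : Filtration ℝ m) (W : ℝ → Ω → ℝ) (C x : ℝ) (Z : ℝ → Ω → ℝ) : Prop where
  cont : ∀ ω, Continuous fun t => Z t ω
  adapted : Adapted ℱ Z
  start : ∀ᵐ ω ∂P, Z 0 ω = x
  lip : ∀ᵐ ω ∂P, ∀ s t, 0 ≤ s → s ≤ t → |Z t ω - W t ω - (Z s ω - W s ω)| ≤ C * (t - s)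

namespace IsDriftedBrownian

variable {Ω : Type*} {m : MeasurableSpace Ω} {P : Measure Ω} {ℱ : Filtration ℝ m}
  {W Z : ℝ → Ω → ℝ} {C x T : ℝ}

lemma measurable (hZ : IsDriftedBrownian P ℱ W C x Z) (t : ℝ) : Measurable (Z t) :=
  hZ.adapted.measurable

lemma measurable_pathMax (hZ : IsDriftedBrownian P ℱ W C x Z) (t : ℝ) :
    Measurable fun ω => pathMax (fun s => Z s ω) t :=
  _root_.measurable_pathMax hZ.cont hZ.measurable t

lemma measurable_pair (hZ : IsDriftedBrownian P ℱ W C x Z) :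
    Measurable fun q : ℝ × Ω => (Z q.1 q.2, pathMax (fun s => Z s q.2) q.1) :=
  (measurable_uncurry_of_continuous_of_measurable hZ.cont hZ.measurable).prodMk
    (measurable_uncurry_of_continuous_of_measurable (u := fun t ω => pathMax (fun s => Z s ω) t)
      (fun ω => continuous_pathMax (hZ.cont ω)) hZ.measurable_pathMax)

lemma abs_sub_le (hZ : IsDriftedBrownian P ℱ W C x Z) (hW : IsStandardBrownianMotion P ℱ W) :
    ∀ᵐ ω ∂P, ∀ t, 0 ≤ t → |Z t ω - x - W t ω| ≤ C * t := by
  filter_upwards [hZ.start, hZ.lip] with ω h0 h t ht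
  have := h 0 t le_rfl ht
  rw [h0, hW.2.1, sub_zero, sub_zero] at this
  rwa [sub_right_comm]

lemma integrable (hZ : IsDriftedBrownian P ℱ W C x Z) [IsProbabilityMeasure P]
    (hW : IsStandardBrownianMotion P ℱ W) {t : ℝ} (ht : 0 ≤ t) : Integrable (Z t) P := by
  have hi : Integrable (W t) P := (hW.memLp_two ht).integrable (by simp)
  refine (hi.abs.add (integrable_const (|x| + C * t))).mono'
    (hZ.measurable t).aestronglyMeasurable ?_
  filter_upwards [hZ.abs_sub_le hW] with ω h
  have h1 := h t ht
  have h2 : Z t ω = (Z t ω - x - W t ω) + x + W t ω := by ring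
  change |Z t ω| ≤ |W t ω| + (|x| + C * t)
  rw [h2]
  refine (abs_add_three _ _ _).trans ?_
  linarith

lemma le_partialSups (hZ : IsDriftedBrownian P ℱ W C x Z) (h : ℝ) :
    ∀ᵐ ω ∂P, ∀ n : ℕ, x ≤ partialSups (fun j : ℕ => Z (j * h) ω) n := by
  filter_upwards [hZ.start] with ω h0 n
  have := le_partialSups_of_le (fun j : ℕ => Z (j * h) ω) (Nat.zero_le n)
  simpa [h0] using this

lemma le_pathMax (hZ : IsDriftedBrownian P ℱ W C x Z) :
    ∀ᵐ ω ∂P, ∀ t, 0 ≤ t → x ≤ pathMax (fun s => Z s ω) t := by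
  filter_upwards [hZ.start] with ω h0 t ht
  rw [← h0]
  exact _root_.le_pathMax (hZ.cont ω) le_rfl ht

lemma integrable_pathMax (hZ : IsDriftedBrownian P ℱ W C x Z) [IsProbabilityMeasure P]
    (hW : IsStandardBrownianMotion P ℱ W) (hC : 0 ≤ C) (hT : 0 < T) :
    Integrable (fun ω => pathMax (fun s => Z s ω) T) P := by
  refine ((hW.integrable_pathMax hT).abs.add (integrable_const (|x| + C * T))).mono'
    (hZ.measurable_pathMax T).aestronglyMeasurable ?_
  filter_upwards [hZ.abs_sub_le hW, hZ.le_pathMax] with ω h hx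
  have h1 : pathMax (fun s => Z s ω) T ≤ x + pathMax (fun t => W t ω) T + C * T := by
    refine pathMax_le hT.le fun u hu => ?_
    have h1 := (abs_le.1 (h u hu.1)).2
    have h2 := _root_.le_pathMax (hW.continuous ω) hu.1 hu.2
    have h3 := mul_le_mul_of_nonneg_left hu.2 hC
    linarith
  have h2 := hx T hT.le
  have h3 := le_abs_self x
  have h4 := neg_abs_le x
  have h5 := le_abs_self (pathMax (fun t => W t ω) T)
  have h6 := abs_nonneg (pathMax (fun t => W t ω) T)
  have h7 : 0 ≤ C * T := by positivity
  change |pathMax (fun s => Z s ω) T| ≤ |pathMax (fun t => W t ω) T| + (|x| + C * T)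
  rw [abs_le]
  constructor <;> linarith

end IsDriftedBrownian

namespace IsDriftedBrownian

variable {Ω : Type*} {m : MeasurableSpace Ω} {P : Measure Ω} [IsProbabilityMeasure P]
  {ℱ : Filtration ℝ m} {W Z : ℝ → Ω → ℝ} {C S L L' L'' x T : ℝ} {f : ℝ → ℝ → ℝ}

lemma integral_le_of_ae_le (hZ : IsDriftedBrownian P ℱ W C x Z)
    (hW : IsStandardBrownianMotion P ℱ W) (hf : IsStripBounded C S f) (hS : 0 ≤ S)
    (hT : 0 < T) {σ κ K : ℝ} (hL'' : 0 ≤ L'') (hK : 0 ≤ K) (hκ : 0 < κ) (hκ1 : κ ≤ 1)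
    {n : ℕ} (hn : 0 < n) (hκn : T / n = κ ^ 4) {V : Ω → ℝ} (hVi : Integrable V P)
    (hV : ∀ᵐ ω ∂P, V ω ≤ ∑ i ∈ Finset.range n,
        (σ * (scaleDensity f (Z (i * (T / n)) ω)
            (partialSups (fun j : ℕ => Z (j * (T / n)) ω) i)
            * (W ((i + 1 : ℕ) * (T / n)) ω - W (i * (T / n)) ω))
          - σ * (f (Z (i * (T / n)) ω) (partialSups (fun j : ℕ => Z (j * (T / n)) ω) i)
            * scaleDensity f (Z (i * (T / n)) ω)
              (partialSups (fun j : ℕ => Z (j * (T / n)) ω) i)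
            * ((W ((i + 1 : ℕ) * (T / n)) ω - W (i * (T / n)) ω) ^ 2 - κ ^ 4)))
        + L'' * κ * (partialSups (fun j : ℕ => Z (j * (T / n)) ω) n - x)
        + K * ∑ i ∈ Finset.range n,
          stepError κ (W ((i + 1 : ℕ) * (T / n)) ω - W (i * (T / n)) ω)) :
    ∫ ω, V ω ∂P ≤ κ * (L'' * (∫ ω, pathMax (fun s => Z s ω) T ∂P - x)
      + K * (T * (2 + ∫ y, y ^ 4 ∂gaussianReal 0 1))) := by
  have hC := hf.nonneg
  set h : ℝ := T / n with hh
  have hn' : (0 : ℝ) < n := by exact_mod_cast hn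
  have hnh : n * h = T := by rw [hh]; field_simp
  have hh0 : 0 < h := by rw [hκn]; positivity
  have ht0 : ∀ i : ℕ, (0 : ℝ) ≤ i * h := fun i => by positivity
  have hle : ∀ i : ℕ, (i : ℝ) * h ≤ ((i + 1 : ℕ) : ℝ) * h := fun i => by push_cast; nlinarith
  have hsub : ∀ i : ℕ, ((i + 1 : ℕ) : ℝ) * h - i * h = κ ^ 4 := fun i => by
    rw [← hκn]; push_cast; ring
  have hpair : ∀ i : ℕ, Measurable[ℱ (i * h)] fun ω =>
      (Z (i * h) ω, partialSups (fun j : ℕ => Z (j * h) ω) i) := fun i =>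
    (hZ.adapted _).prodMk (IsStandardBrownianMotion.measurable_partialSups hZ.adapted hh0.le i)
  have hpm : ∀ i : ℕ, Measurable[ℱ (i * h)] fun ω =>
      scaleDensity f (Z (i * h) ω) (partialSups (fun j : ℕ => Z (j * h) ω) i) := fun i =>
    hf.measurable_scaleDensity.comp (hpair i)
  have hfm : ∀ i : ℕ, Measurable[ℱ (i * h)] fun ω =>
      f (Z (i * h) ω) (partialSups (fun j : ℕ => Z (j * h) ω) i) := fun i =>
    hf.meas.comp (hpair i)
  have hfpm : ∀ i : ℕ, Measurable[ℱ (i * h)] fun ω =>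
      f (Z (i * h) ω) (partialSups (fun j : ℕ => Z (j * h) ω) i)
      * scaleDensity f (Z (i * h) ω) (partialSups (fun j : ℕ => Z (j * h) ω) i) := fun i =>
    (hfm i).mul (hpm i)
  have hpabs : ∀ u v, |scaleDensity f u v| ≤ Real.exp (4 * C * S) := fun u v => by
    rw [abs_of_pos (scaleDensity_pos f u v)]
    exact hf.scaleDensity_le hS u v
  have hpi : ∀ i : ℕ, Integrable (fun ω =>
      scaleDensity f (Z (i * h) ω) (partialSups (fun j : ℕ => Z (j * h) ω) i)) P := fun i =>
    (integrable_const (Real.exp (4 * C * S))).mono'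
      ((hpm i).mono (ℱ.le _) le_rfl).aestronglyMeasurable (ae_of_all _ fun ω => hpabs _ _)
  have hfpi : ∀ i : ℕ, Integrable (fun ω =>
      f (Z (i * h) ω) (partialSups (fun j : ℕ => Z (j * h) ω) i)
      * scaleDensity f (Z (i * h) ω) (partialSups (fun j : ℕ => Z (j * h) ω) i)) P := fun i =>
    (integrable_const (C * Real.exp (4 * C * S))).mono'
      ((hfpm i).mono (ℱ.le _) le_rfl).aestronglyMeasurable (ae_of_all _ fun ω => by
        rw [Real.norm_eq_abs, abs_mul]
        exact mul_le_mul (hf.bdd _ _) (hpabs _ _) (abs_nonneg _) hC)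
  have hm1 := fun i : ℕ => hW.integrable_mul_sub (ht0 i) (hle i) (hpm i) (hpi i)
  have hm1' := fun i : ℕ => hW.integral_mul_sub (ht0 i) (hle i) (hpm i)
  have hm2 := fun i : ℕ => hW.integrable_mul_sub_sq (ht0 i) (hle i) (hfpm i) (hfpi i)
  have hm2' := fun i : ℕ => hW.integral_mul_sub_sq (ht0 i) (hle i) (hfpm i)
  simp only [hsub] at hm2 hm2'
  have hmart := fun i : ℕ => ((hm1 i).const_mul σ).sub ((hm2 i).const_mul σ)
  have hM := hZ.integrable_pathMax hW hC hT
  have hNle : ∀ ω, partialSups (fun j : ℕ => Z (j * h) ω) n ≤ pathMax (fun s => Z s ω) T :=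
    fun ω => partialSups_grid_le_pathMax (hZ.cont ω) hh0.le hnh.le
  have hNi : Integrable (fun ω => partialSups (fun j : ℕ => Z (j * h) ω) n) P := by
    refine (hM.abs.add (integrable_const |x|)).mono'
      ((IsStandardBrownianMotion.measurable_partialSups hZ.adapted hh0.le n).mono
        (ℱ.le _) le_rfl).aestronglyMeasurable ?_
    filter_upwards [hZ.le_partialSups h] with ω hx
    change |partialSups (fun j : ℕ => Z (j * h) ω) n| ≤ |pathMax (fun s => Z s ω) T| + |x|
    have h1 := hx n
    have h2 := hNle ω
    have h3 := le_abs_self (pathMax (fun s => Z s ω) T)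
    have h4 := neg_abs_le x
    have h5 := abs_nonneg (pathMax (fun s => Z s ω) T)
    have h6 := abs_nonneg x
    rw [abs_le]
    constructor <;> linarith
  have hE1 := fun i : ℕ => hW.integrable_sub_pow (ht0 i) (hle i) 2
  have hE2 := fun i : ℕ => hW.integrable_sub_pow (ht0 i) (hle i) 4
  have hEi : ∀ i : ℕ, Integrable (fun ω => stepError κ (W ((i + 1 : ℕ) * h) ω - W (i * h) ω)) P :=
    fun i => ((integrable_const _).add ((hE1 i).const_mul _)).add ((hE2 i).div_const _)
  have hEint : ∀ i : ℕ, ∫ ω, stepError κ (W ((i + 1 : ℕ) * h) ω - W (i * h) ω) ∂P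
      = h * (κ ^ 2 * (2 + ∫ y, y ^ 4 ∂gaussianReal 0 1)) := by
    intro i
    have e1 : Integrable (fun ω => κ ^ 6 + κ ^ 2 * (W ((i + 1 : ℕ) * h) ω - W (i * h) ω) ^ 2) P :=
      (integrable_const _).add ((hE1 i).const_mul _)
    simp only [stepError]
    rw [integral_add e1 ((hE2 i).div_const _),
      integral_add (integrable_const _) ((hE1 i).const_mul _), integral_const_mul, integral_div,
      hW.integral_sub_sq (ht0 i) (hle i), hW.integral_sub_pow_four (ht0 i) (hle i), hsub, hκn]
    simp only [integral_const, probReal_univ, smul_eq_mul, one_mul]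
    field_simp
    ring
  have hR1 := integrable_finsetSum (Finset.range n) fun i _ => hmart i
  have hR2 := (hNi.sub (integrable_const x)).const_mul (L'' * κ)
  have hR3 := (integrable_finsetSum (Finset.range n) fun i _ => hEi i).const_mul K
  have hmono := integral_mono_ae hVi ((hR1.add hR2).add hR3) (by
    filter_upwards [hV] with ω hω
    exact hω)
  refine hmono.trans ?_
  rw [integral_add' (hR1.add hR2) hR3, integral_add' hR1 hR2, integral_const_mul,
    integral_const_mul, integral_finsetSum _ fun i _ => hmart i,
    integral_finsetSum _ fun i _ => hEi i]
  have hz : ∀ i ∈ Finset.range n, ∫ ω, ((fun ω => σ * (scaleDensity f (Z (i * h) ω)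
      (partialSups (fun j : ℕ => Z (j * h) ω) i)
        * (W ((i + 1 : ℕ) * h) ω - W (i * h) ω))) - fun ω => σ * (f (Z (i * h) ω)
          (partialSups (fun j : ℕ => Z (j * h) ω) i)
      * scaleDensity f (Z (i * h) ω) (partialSups (fun j : ℕ => Z (j * h) ω) i)
        * ((W ((i + 1 : ℕ) * h) ω - W (i * h) ω) ^ 2 - κ ^ 4))) ω ∂P = 0 := by
    intro i _
    rw [integral_sub' ((hm1 i).const_mul σ) ((hm2 i).const_mul σ), integral_const_mul,
      integral_const_mul, hm1', hm2']
    simp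
  rw [Finset.sum_eq_zero hz]
  simp only [hEint, Finset.sum_const, Finset.card_range, nsmul_eq_mul]
  have hN : ∫ ω, ((fun ω => partialSups (fun j : ℕ => Z (j * h) ω) n) - fun _ : Ω => x) ω ∂P
      ≤ ∫ ω, pathMax (fun s => Z s ω) T ∂P - x := by
    rw [integral_sub' hNi (integrable_const x)]
    have := integral_mono hNi hM hNle
    simpa using this
  have hc4 : 0 ≤ ∫ y, y ^ 4 ∂gaussianReal 0 1 := integral_nonneg fun y => by positivity
  have h1 := mul_le_mul_of_nonneg_left hN (mul_nonneg hL'' hκ.le)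
  have h2 : κ ^ 2 ≤ κ := by nlinarith
  have h3 : n * (h * (κ ^ 2 * (2 + ∫ y, y ^ 4 ∂gaussianReal 0 1)))
      ≤ κ * (T * (2 + ∫ y, y ^ 4 ∂gaussianReal 0 1)) := by
    rw [← mul_assoc, hnh]
    have := mul_le_mul_of_nonneg_left h2 (by positivity :
      0 ≤ T * (2 + ∫ y, y ^ 4 ∂gaussianReal 0 1))
    linarith
  have h4 := mul_le_mul_of_nonneg_left h3 hK
  linarith

end IsDriftedBrownian

lemma stepConst_nonneg {C S L' L'' : ℝ} (hC : 0 ≤ C) (hL' : 0 ≤ L') (hL'' : 0 ≤ L'') :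
    0 ≤ stepConst C S L' L'' := by
  unfold stepConst
  positivity

namespace IsDriftedBrownian

variable {Ω : Type*} {m : MeasurableSpace Ω} {P : Measure Ω}
  {ℱ : Filtration ℝ m} {W Z : ℝ → Ω → ℝ} {C S L x T : ℝ} {f g : ℝ → ℝ → ℝ}

lemma measurable_drift (hZ : IsDriftedBrownian P ℱ W C x Z)
    (hg : Measurable (Function.uncurry g)) :
    Measurable fun q : ℝ × Ω => g (Z q.1 q.2) (pathMax (fun s => Z s q.2) q.1) :=
  hg.comp hZ.measurable_pair

lemma measurable_intervalIntegral {G : ℝ × Ω → ℝ} (hG : Measurable G) (a b : ℝ) :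
    Measurable fun ω => ∫ s in a..b, G (s, ω) := by
  have h : ∀ A : Set ℝ, Measurable fun ω => ∫ s in A, G (s, ω) := fun A =>
    ((hG.comp measurable_swap).stronglyMeasurable.integral_prod_right'
      (ν := volume.restrict A)).measurable
  exact (h _).sub (h _)

/-- The discrete approximation of `σ (H(Z_T, M_T) - ∫ p (g - f) d s)` on the grid of mesh
`T / n`. -/
noncomputable def gridValue (f g : ℝ → ℝ → ℝ) (Z : ℝ → Ω → ℝ) (σ x T : ℝ) (n : ℕ) (ω : Ω) : ℝ :=
  σ * (maxHarmonic f x (Z (n * (T / n)) ω) (partialSups (fun j : ℕ => Z (j * (T / n)) ω) n)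
    - (∑ i ∈ Finset.range n,
        scaleDensity f (Z (i * (T / n)) ω) (partialSups (fun j : ℕ => Z (j * (T / n)) ω) i)
          * (∫ s in (i * (T / n) : ℝ)..((i + 1 : ℕ) * (T / n) : ℝ),
              g (Z s ω) (pathMax (fun s => Z s ω) s))
      - ∑ i ∈ Finset.range n,
        f (Z (i * (T / n)) ω) (partialSups (fun j : ℕ => Z (j * (T / n)) ω) i)
          * scaleDensity f (Z (i * (T / n)) ω) (partialSups (fun j : ℕ => Z (j * (T / n)) ω) i)
          * (∫ _ in (i * (T / n) : ℝ)..((i + 1 : ℕ) * (T / n) : ℝ), (1 : ℝ))))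

lemma measurable_gridValue (hZ : IsDriftedBrownian P ℱ W C x Z) (hf : IsStripBounded C S f)
    (hS : 0 ≤ S) (hL : IsPlaneLipschitz L f) (hg : Measurable (Function.uncurry g))
    (σ : ℝ) (hT : 0 < T) (n : ℕ) : Measurable (gridValue f g Z σ x T n) := by
  have hpair : ∀ i : ℕ, Measurable fun ω =>
      (Z (i * (T / n)) ω, partialSups (fun j : ℕ => Z (j * (T / n)) ω) i) := fun i =>
    ((hZ.adapted _).prodMk (IsStandardBrownianMotion.measurable_partialSups hZ.adapted
      (by positivity) i)).mono (ℱ.le _) le_rfl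
  have hp : ∀ i : ℕ, Measurable fun ω =>
      scaleDensity f (Z (i * (T / n)) ω) (partialSups (fun j : ℕ => Z (j * (T / n)) ω) i) :=
    fun i => hf.measurable_scaleDensity.comp (hpair i)
  have hfm : ∀ i : ℕ, Measurable fun ω =>
      f (Z (i * (T / n)) ω) (partialSups (fun j : ℕ => Z (j * (T / n)) ω) i) :=
    fun i => hf.meas.comp (hpair i)
  have hH : Measurable fun ω => maxHarmonic f x (Z (n * (T / n)) ω)
      (partialSups (fun j : ℕ => Z (j * (T / n)) ω) n) :=
    (hf.continuous_maxHarmonic hS hL x).measurable.comp (hpair n)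
  unfold gridValue
  refine (hH.sub ((Finset.measurable_fun_sum _ fun i _ => (hp i).mul ?_).sub
    (Finset.measurable_fun_sum _ fun i _ => ((hfm i).mul (hp i)).mul_const _))).const_mul _
  exact measurable_intervalIntegral (hZ.measurable_drift hg) _ _

lemma abs_gridValue_le (hZ : IsDriftedBrownian P ℱ W C x Z) (hf : IsStripBounded C S f)
    (hS : 0 ≤ S) (hgC : ∀ u m, |g u m| ≤ C) {σ : ℝ} (hσ : |σ| ≤ 1) (hT : 0 < T)
    {n : ℕ} (hn : 0 < n) : ∀ᵐ ω ∂P, |gridValue f g Z σ x T n ω|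
      ≤ Real.exp (4 * C * S) * (3 * |x| + |Z T ω| + 2 * |pathMax (fun s => Z s ω) T|)
        + 2 * (Real.exp (4 * C * S) * C * T) := by
  filter_upwards [hZ.le_partialSups (T / n)] with ω hx
  have hC := hf.nonneg
  set B := Real.exp (4 * C * S) with hB
  have hB0 : 0 < B := Real.exp_pos _
  have hn' : (0 : ℝ) < n := by exact_mod_cast hn
  have hnT : (n : ℝ) * (T / n) = T := by field_simp
  have hstep : ∀ i : ℕ, |((i + 1 : ℕ) : ℝ) * (T / n) - i * (T / n)| = T / n := fun i => by
    rw [show ((i + 1 : ℕ) : ℝ) * (T / n) - i * (T / n) = T / n by push_cast; ring,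
      abs_of_nonneg (by positivity)]
  have hN : |partialSups (fun j : ℕ => Z (j * (T / n)) ω) n|
      ≤ |x| + |pathMax (fun s => Z s ω) T| := by
    have h1 := hx n
    have h2 := partialSups_grid_le_pathMax (hZ.cont ω) (by positivity) hnT.le
    have h3 := le_abs_self (pathMax (fun s => Z s ω) T)
    have h4 := neg_abs_le x
    have h5 := abs_nonneg (pathMax (fun s => Z s ω) T)
    have h6 := abs_nonneg x
    rw [abs_le]
    constructor <;> linarith
  have hp : ∀ u v, |scaleDensity f u v| ≤ B := fun u v => by
    rw [abs_of_pos (scaleDensity_pos f u v)]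
    exact hf.scaleDensity_le hS u v
  have hsum : ∀ F : ℕ → ℝ, (∀ i, |F i| ≤ B * C * (T / n)) →
      |∑ i ∈ Finset.range n, F i| ≤ B * C * T := fun F hF => by
    refine (Finset.abs_sum_le_sum_abs _ _).trans ((Finset.sum_le_sum fun i _ => hF i).trans ?_)
    rw [Finset.sum_const, Finset.card_range, nsmul_eq_mul]
    field_simp
    exact le_rfl
  have hH := hf.abs_maxHarmonic_le hS x (Z (n * (T / n)) ω)
    (partialSups (fun j : ℕ => Z (j * (T / n)) ω) n)
  have h1 := hsum (fun i =>
        scaleDensity f (Z (i * (T / n)) ω) (partialSups (fun j : ℕ => Z (j * (T / n)) ω) i)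
          * (∫ s in (i * (T / n) : ℝ)..((i + 1 : ℕ) * (T / n) : ℝ),
              g (Z s ω) (pathMax (fun s => Z s ω) s))) fun i => by
    rw [abs_mul, mul_assoc]
    refine mul_le_mul (hp _ _) ?_ (abs_nonneg _) hB0.le
    have := intervalIntegral.norm_integral_le_of_norm_le_const (a := (i * (T / n) : ℝ))
      (b := ((i + 1 : ℕ) * (T / n) : ℝ)) (f := fun s => g (Z s ω) (pathMax (fun s => Z s ω) s))
      fun s _ => hgC _ _
    rwa [hstep] at this
  have h2 := hsum (fun i =>
        f (Z (i * (T / n)) ω) (partialSups (fun j : ℕ => Z (j * (T / n)) ω) i)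
          * scaleDensity f (Z (i * (T / n)) ω) (partialSups (fun j : ℕ => Z (j * (T / n)) ω) i)
          * (∫ _ in (i * (T / n) : ℝ)..((i + 1 : ℕ) * (T / n) : ℝ), (1 : ℝ))) fun i => by
    rw [intervalIntegral.integral_const, smul_eq_mul, mul_one, abs_mul, abs_mul, hstep,
      mul_comm B]
    exact mul_le_mul_of_nonneg_right
      (mul_le_mul (hf.bdd _ _) (hp _ _) (abs_nonneg _) hC) (by positivity)
  rw [gridValue, abs_mul]
  refine (mul_le_of_le_one_left (abs_nonneg _) hσ).trans ((abs_sub _ _).trans ?_)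
  rw [hnT] at hH ⊢
  refine add_le_add (hH.trans (mul_le_mul_of_nonneg_left ?_ hB0.le)) ((abs_sub _ _).trans ?_)
  · linarith
  · linarith

lemma tendsto_gridValue (hZ : IsDriftedBrownian P ℱ W C x Z) (hf : IsStripBounded C S f)
    (hS : 0 ≤ S) (hL : IsPlaneLipschitz L f) (hg : Measurable (Function.uncurry g))
    (hgC : ∀ u m, |g u m| ≤ C) (σ : ℝ) (hT : 0 < T) (ω : Ω) :
    Filter.Tendsto (fun n => gridValue f g Z σ x T n ω) Filter.atTop
      (nhds (σ * (maxHarmonic f x (Z T ω) (pathMax (fun s => Z s ω) T)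
        - ((∫ s in (0 : ℝ)..T, scaleDensity f (Z s ω) (pathMax (fun s => Z s ω) s)
            * g (Z s ω) (pathMax (fun s => Z s ω) s))
          - ∫ s in (0 : ℝ)..T, f (Z s ω) (pathMax (fun s => Z s ω) s)
            * scaleDensity f (Z s ω) (pathMax (fun s => Z s ω) s) * 1)))) := by
  have hp := hf.isPlaneLipschitz_scaleDensity hS hL
  have hfp := hL.mul hp hf.bdd fun u v => by
    rw [abs_of_pos (scaleDensity_pos f u v)]
    exact hf.scaleDensity_le hS u v
  have hG : Measurable fun s => g (Z s ω) (pathMax (fun s => Z s ω) s) :=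
    (hZ.measurable_drift hg).comp (measurable_id.prodMk measurable_const)
  have h1 := tendsto_grid_sum (hZ.cont ω) hp hG (fun s => hgC _ _) hT
  have h2 := tendsto_grid_sum (G := fun _ => 1) (C := 1) (hZ.cont ω) hfp measurable_const
    (fun s => by simp) hT
  have h3 : Filter.Tendsto (fun n : ℕ => Z (n * (T / n)) ω) Filter.atTop (nhds (Z T ω)) := by
    refine tendsto_const_nhds.congr' ?_
    filter_upwards [Filter.eventually_gt_atTop 0] with n hn
    have hn' : (0 : ℝ) < n := by exact_mod_cast hn
    rw [show (n : ℝ) * (T / n) = T by field_simp]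
  have h4 := ((hf.continuous_maxHarmonic hS hL x).tendsto
    (Z T ω, pathMax (fun s => Z s ω) T)).comp
    (h3.prodMk_nhds (tendsto_partialSups_grid (hZ.cont ω) hT))
  exact (h4.sub (h1.sub h2)).const_mul σ

variable [IsProbabilityMeasure P]

lemma integral_gridValue_le (hZ : IsDriftedBrownian P ℱ W C x Z)
    (hW : IsStandardBrownianMotion P ℱ W) (hf : IsStripBounded C S f) (hS : 0 ≤ S)
    (hL : IsPlaneLipschitz L f) {σ : ℝ} (hσ : |σ| ≤ 1)
    (hdrift : ∀ᵐ ω ∂P, ∀ s t, 0 ≤ s → s ≤ t → σ * (Z t ω - W t ω - (Z s ω - W s ω))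
      ≤ σ * ∫ r in s..t, g (Z r ω) (pathMax (fun s => Z s ω) r)) (hT : 0 < T) :
    ∃ K : ℝ, ∀ n : ℕ, 0 < n → T / n ≤ 1 → Integrable (gridValue f g Z σ x T n) P →
      ∫ ω, gridValue f g Z σ x T n ω ∂P ≤ √√(T / n) * K := by
  have hp := hf.isPlaneLipschitz_scaleDensity hS hL
  have hfp := hL.mul hp hf.bdd fun u v => by
    rw [abs_of_pos (scaleDensity_pos f u v)]
    exact hf.scaleDensity_le hS u v
  refine ⟨_, fun n hn hn1 hi => integral_le_of_ae_le hZ hW hf hS hT (σ := σ) hp.nonneg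
    (stepConst_nonneg (S := S) hf.nonneg hfp.nonneg hp.nonneg) ?_ ?_ hn ?_ hi ?_⟩
  · have hn' : (0 : ℝ) < n := by exact_mod_cast hn
    positivity
  · exact Real.sqrt_le_one.2 (Real.sqrt_le_one.2 hn1)
  · rw [show √√(T / n) ^ 4 = (√√(T / n) ^ 2) ^ 2 by ring, Real.sq_sqrt (by positivity),
      Real.sq_sqrt (by positivity)]
  · have hn' : (0 : ℝ) < n := by exact_mod_cast hn
    have hκ : √√(T / n) ^ 4 = T / n := by
      rw [show √√(T / n) ^ 4 = (√√(T / n) ^ 2) ^ 2 by ring, Real.sq_sqrt (by positivity),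
        Real.sq_sqrt (by positivity)]
    filter_upwards [hZ.start, hZ.lip, hdrift] with ω h0 hlip hd
    have hle : ∀ i : ℕ, (i : ℝ) * (T / n) ≤ ((i + 1 : ℕ) : ℝ) * (T / n) := fun i => by
      gcongr; simp
    have h0i : ∀ i : ℕ, 0 ≤ (i : ℝ) * (T / n) := fun i => by positivity
    have := hf.maxHarmonic_sum_le hS hL hp hfp hσ (κ := √√(T / n)) (by positivity)
      (Real.sqrt_le_one.2 (Real.sqrt_le_one.2 hn1))
      (x := x) (z := fun j : ℕ => Z (j * (T / n)) ω)
      (w := fun i : ℕ => W ((i + 1 : ℕ) * (T / n)) ω - W (i * (T / n)) ω)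
      (a := fun i : ℕ => Z ((i + 1 : ℕ) * (T / n)) ω - W ((i + 1 : ℕ) * (T / n)) ω
        - (Z (i * (T / n)) ω - W (i * (T / n)) ω))
      (I := fun i : ℕ => ∫ s in (i * (T / n) : ℝ)..((i + 1 : ℕ) * (T / n) : ℝ),
              g (Z s ω) (pathMax (fun s => Z s ω) s)) n (by simpa using h0)
      (fun i _ => by ring) (fun i _ => by
        refine (hlip _ _ (h0i i) (hle i)).trans_eq ?_
        rw [hκ]; push_cast; ring) (fun i _ => hd _ _ (h0i i) (hle i))
    refine le_trans (le_of_eq ?_) this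
    rw [gridValue, mul_sub σ, ← Finset.sum_sub_distrib, Finset.mul_sum, hκ]
    congr 1
    refine Finset.sum_congr rfl fun i _ => ?_
    rw [intervalIntegral.integral_const, smul_eq_mul, mul_one,
      show ((i + 1 : ℕ) : ℝ) * (T / n) - i * (T / n) = T / n by push_cast; ring]

/-- One-sided Dynkin inequality for the function `maxHarmonic f` of a drifted Brownian motion
and its running maximum. -/
lemma integral_maxHarmonic_le (hZ : IsDriftedBrownian P ℱ W C x Z)
    (hW : IsStandardBrownianMotion P ℱ W) (hf : IsStripBounded C S f) (hS : 0 ≤ S)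
    (hL : IsPlaneLipschitz L f) (hg : Measurable (Function.uncurry g))
    (hgC : ∀ u m, |g u m| ≤ C) {σ : ℝ} (hσ : |σ| ≤ 1)
    (hdrift : ∀ᵐ ω ∂P, ∀ s t, 0 ≤ s → s ≤ t → σ * (Z t ω - W t ω - (Z s ω - W s ω))
      ≤ σ * ∫ r in s..t, g (Z r ω) (pathMax (fun s => Z s ω) r)) (hT : 0 < T) :
    ∫ ω, σ * (maxHarmonic f x (Z T ω) (pathMax (fun s => Z s ω) T)
        - ((∫ s in (0 : ℝ)..T, scaleDensity f (Z s ω) (pathMax (fun s => Z s ω) s)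
            * g (Z s ω) (pathMax (fun s => Z s ω) s))
          - ∫ s in (0 : ℝ)..T, f (Z s ω) (pathMax (fun s => Z s ω) s)
            * scaleDensity f (Z s ω) (pathMax (fun s => Z s ω) s) * 1)) ∂P ≤ 0 := by
  have hC := hf.nonneg
  obtain ⟨K, hK⟩ := hZ.integral_gridValue_le hW hf hS hL hσ hdrift hT
  have hbound : Integrable (fun ω =>
      Real.exp (4 * C * S) * (3 * |x| + |Z T ω| + 2 * |pathMax (fun s => Z s ω) T|)
        + 2 * (Real.exp (4 * C * S) * C * T)) P :=
    ((((integrable_const _).add (hZ.integrable hW hT.le).abs).add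
      ((hZ.integrable_pathMax hW hC hT).abs.const_mul 2)).const_mul _).add (integrable_const _)
  have hlim := tendsto_integral_filter_of_dominated_convergence _
    (Filter.Eventually.of_forall fun n =>
      (hZ.measurable_gridValue hf hS hL hg σ hT n).aestronglyMeasurable)
    ((Filter.eventually_gt_atTop 0).mono fun n hn => hZ.abs_gridValue_le hf hS hgC hσ hT hn)
    hbound (ae_of_all P fun ω => hZ.tendsto_gridValue hf hS hL hg hgC σ hT ω)
  have hmesh := tendsto_const_div_atTop_nhds_zero_nat T
  have hzero : Filter.Tendsto (fun n : ℕ => √√(T / n) * K) Filter.atTop (nhds 0) := by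
    have := (hmesh.sqrt.sqrt).mul_const K
    simpa using this
  refine le_of_tendsto_of_tendsto hlim hzero ?_
  filter_upwards [Filter.eventually_gt_atTop 0, hmesh.eventually (gt_mem_nhds one_pos)]
    with n hn hn1
  exact hK n hn hn1.le (hbound.mono'
    (hZ.measurable_gridValue hf hS hL hg σ hT n).aestronglyMeasurable
    (hZ.abs_gridValue_le hf hS hgC hσ hT hn))

end IsDriftedBrownian

lemma intervalIntegrable_of_abs_le {C : ℝ} {a : ℝ → ℝ} (ha : Measurable a)
    (haC : ∀ s, |a s| ≤ C) (s t : ℝ) : IntervalIntegrable a volume s t :=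
  (intervalIntegrable_const (c := C)).mono_fun ha.aestronglyMeasurable
    (ae_of_all _ fun r => by
      simp only [Real.norm_eq_abs]
      exact (haC r).trans (le_abs_self C))

lemma abs_intervalIntegral_le {C : ℝ} {a : ℝ → ℝ} (haC : ∀ s, |a s| ≤ C) {s t : ℝ} (hst : s ≤ t) :
    |∫ r in s..t, a r| ≤ C * (t - s) := by
  have := intervalIntegral.norm_integral_le_of_norm_le_const (a := s) (b := t) (f := a)
    fun r _ => haC r
  rwa [Real.norm_eq_abs, abs_of_nonneg (sub_nonneg.2 hst)] at this

lemma abs_max_sub_max_le_of_integral {C : ℝ} {A B a b : ℝ → ℝ}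
    (haC : ∀ s, |a s| ≤ C) (hbC : ∀ s, |b s| ≤ C)
    (hA : ∀ s t, 0 ≤ s → s ≤ t → A t - A s = ∫ r in s..t, a r)
    (hB : ∀ s t, 0 ≤ s → s ≤ t → B t - B s = ∫ r in s..t, b r) {s t : ℝ} (hs : 0 ≤ s)
    (hst : s ≤ t) : |max (A t) (B t) - max (A s) (B s)| ≤ C * (t - s) := by
  refine (abs_max_sub_max_le_max _ _ _ _).trans (max_le ?_ ?_)
  · rw [hA s t hs hst]
    exact abs_intervalIntegral_le haC hst
  · rw [hB s t hs hst]
    exact abs_intervalIntegral_le hbC hst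

lemma max_sub_max_le_integral {C : ℝ} {A B a b g : ℝ → ℝ} (ha : Measurable a) (hb : Measurable b)
    (hg : Measurable g) (haC : ∀ s, |a s| ≤ C) (hbC : ∀ s, |b s| ≤ C) (hgC : ∀ s, |g s| ≤ C)
    (hA : ∀ s t, 0 ≤ s → s ≤ t → A t - A s = ∫ r in s..t, a r)
    (hB : ∀ s t, 0 ≤ s → s ≤ t → B t - B s = ∫ r in s..t, b r)
    (hag : ∀ s, 0 ≤ s → B s ≤ A s → a s ≤ g s) (hbg : ∀ s, 0 ≤ s → A s ≤ B s → b s ≤ g s)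
    {s t : ℝ} (hs : 0 ≤ s) (hst : s ≤ t) :
    max (A t) (B t) - max (A s) (B s) ≤ ∫ r in s..t, g r := by
  have hC : 0 ≤ C := (abs_nonneg _).trans (haC 0)
  set V : ℝ → ℝ := fun r => max (A r) (B r) with hV
  have hlip : LipschitzOnWith ⟨C, hC⟩ V (uIcc s t) := by
    rw [uIcc_of_le hst]
    refine LipschitzOnWith.of_dist_le_mul fun u hu v hv => ?_
    change |V u - V v| ≤ C * |u - v|
    rcases le_total u v with h | h
    · rw [abs_sub_comm, abs_sub_comm u, abs_of_nonneg (sub_nonneg.2 h)]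
      exact abs_max_sub_max_le_of_integral haC hbC hA hB (hs.trans hu.1) h
    · rw [abs_of_nonneg (sub_nonneg.2 h)]
      exact abs_max_sub_max_le_of_integral haC hbC hA hB (hs.trans hv.1) h
  have hac := hlip.absolutelyContinuousOnInterval
  change V t - V s ≤ _
  rw [← hac.integral_deriv_eq_sub]
  refine intervalIntegral.integral_mono_ae_restrict hst hac.intervalIntegrable_deriv
    (intervalIntegrable_of_abs_le hg hgC s t) ?_
  have hderiv : ∀ {F e : ℝ → ℝ}, Measurable e → (∀ r, |e r| ≤ C) →
      (∀ s t, 0 ≤ s → s ≤ t → F t - F s = ∫ r in s..t, e r) →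
      ∀ᵐ r, r ∈ uIcc s t → r ∈ Ioo s t → HasDerivAt F (e r) r := by
    intro F e he heC hF
    filter_upwards [(intervalIntegrable_of_abs_le he heC s t).ae_hasDerivAt_integral]
      with r hr hrI hrO
    have h1 := (hr hrI s left_mem_uIcc).add_const (F s)
    refine h1.congr_of_eventuallyEq ?_
    filter_upwards [Ioo_mem_nhds hrO.1 hrO.2] with v hv
    have := hF s v hs hv.1.le
    linarith
  have hmin : ∀ {F : ℝ → ℝ} {e r : ℝ}, (∀ v, F v ≤ V v) → V r = F r → DifferentiableAt ℝ V r →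
      HasDerivAt F e r → deriv V r = e := by
    intro F e r hle heq hd hF
    have h1 : IsLocalMin (fun v => V v - F v) r := by
      refine Filter.Eventually.of_forall fun v => ?_
      have := hle v
      change V r - F r ≤ V v - F v
      linarith
    have := h1.hasDerivAt_eq_zero (hd.hasDerivAt.sub hF)
    linarith
  have hne : ∀ᵐ r : ℝ, r ≠ s ∧ r ≠ t := by
    filter_upwards [compl_mem_ae_iff.2 (measure_singleton s),
      compl_mem_ae_iff.2 (measure_singleton t)] with r h1 h2
    exact ⟨h1, h2⟩
  rw [Filter.EventuallyLE, ae_restrict_iff' measurableSet_Icc]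
  filter_upwards [hderiv ha haC hA, hderiv hb hbC hB, hac.ae_differentiableAt, hne]
    with r hr1 hr2 hr3 hr4 hr
  have hrI : r ∈ uIcc s t := by rwa [uIcc_of_le hst]
  have hrO : r ∈ Ioo s t := ⟨lt_of_le_of_ne hr.1 (Ne.symm hr4.1), lt_of_le_of_ne hr.2 hr4.2⟩
  rcases le_total (B r) (A r) with h | h
  · rw [hmin (fun v => le_max_left _ _) (max_eq_left h) (hr3 hrI) (hr1 hrI hrO)]
    exact hag r (hs.trans hr.1) h
  · rw [hmin (fun v => le_max_right _ _) (max_eq_right h) (hr3 hrI) (hr2 hrI hrO)]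
    exact hbg r (hs.trans hr.1) h

/-- `Z - W` has drift `b (Z, max Z)`. -/
structure IsMaxDriftSolution {Ω : Type*} {m : MeasurableSpace Ω} (P : Measure Ω)
    (ℱ : Filtration ℝ m) (W : ℝ → Ω → ℝ) (b : ℝ → ℝ → ℝ) (C x : ℝ) (Z : ℝ → Ω → ℝ) : Prop
    extends IsDriftedBrownian P ℱ W C x Z where
  drift : ∀ᵐ ω ∂P, ∀ s t, 0 ≤ s → s ≤ t → Z t ω - W t ω - (Z s ω - W s ω)
    = ∫ r in s..t, b (Z r ω) (pathMax (fun s => Z s ω) r)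

namespace IsMaxDriftSolution

variable {Ω : Type*} {m : MeasurableSpace Ω} {P : Measure Ω}
  {ℱ : Filtration ℝ m} {W X Y Z : ℝ → Ω → ℝ} {C x : ℝ} {b : ℝ → ℝ → ℝ}

lemma measurable_drift_path (hb : Measurable (Function.uncurry b)) {z : ℝ → ℝ}
    (hz : Continuous z) : Measurable fun s => b (z s) (pathMax z s) :=
  hb.comp (hz.measurable.prodMk (continuous_pathMax hz).measurable)

lemma of_integral_equation (hb : Measurable (Function.uncurry b)) (hbC : ∀ u m, |b u m| ≤ C)
    (hW : IsStandardBrownianMotion P ℱ W) (hc : ∀ ω, Continuous fun t => Z t ω)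
    (had : Adapted ℱ Z)
    (hsol : ∀ᵐ ω ∂P, ∀ t : ℝ, 0 ≤ t → Z t ω = x + W t ω +
        ∫ s in (0:ℝ)..t, b (Z s ω) (sSup ((fun u => Z u ω) '' Set.Icc 0 s))) :
    IsMaxDriftSolution P ℱ W b C x Z := by
  have hsol' : ∀ᵐ ω ∂P, ∀ t : ℝ, 0 ≤ t → Z t ω = x + W t ω +
      ∫ s in (0:ℝ)..t, b (Z s ω) (pathMax (fun u => Z u ω) s) := by
    filter_upwards [hsol] with ω h t ht
    rw [h t ht]
    congr 1
    refine intervalIntegral.integral_congr fun s hs => ?_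
    rw [uIcc_of_le ht] at hs
    rw [pathMax_of_nonneg _ hs.1]
  have hdrift : ∀ᵐ ω ∂P, ∀ s t, 0 ≤ s → s ≤ t → Z t ω - W t ω - (Z s ω - W s ω)
      = ∫ r in s..t, b (Z r ω) (pathMax (fun s => Z s ω) r) := by
    filter_upwards [hsol'] with ω h s t hs hst
    have hi := intervalIntegrable_of_abs_le (measurable_drift_path hb (hc ω)) fun s => hbC _ _
    have := intervalIntegral.integral_add_adjacent_intervals (hi 0 s) (hi s t)
    have h1 := h s hs
    have h2 := h t (hs.trans hst)
    linarith
  refine ⟨⟨hc, had, ?_, ?_⟩, hdrift⟩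
  · filter_upwards [hsol'] with ω h
    rw [h 0 le_rfl, hW.2.1, intervalIntegral.integral_same]
    ring
  · filter_upwards [hdrift] with ω h s t hs hst
    rw [h s t hs hst]
    exact abs_intervalIntegral_le (fun s => hbC _ _) hst

lemma isDriftedBrownian_max (hb : ∀ u m, |b u m| ≤ C) (hX : IsMaxDriftSolution P ℱ W b C x X)
    (hY : IsMaxDriftSolution P ℱ W b C x Y) :
    IsDriftedBrownian P ℱ W C x fun t ω => max (X t ω) (Y t ω) where
  cont ω := (hX.cont ω).max (hY.cont ω)
  adapted t := (hX.adapted t).max (hY.adapted t)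
  start := by
    filter_upwards [hX.start, hY.start] with ω h1 h2
    rw [h1, h2, max_self]
  lip := by
    filter_upwards [hX.drift, hY.drift] with ω h1 h2 s t hs hst
    rw [← max_sub_sub_right (X t ω), ← max_sub_sub_right (X s ω)]
    exact abs_max_sub_max_le_of_integral (A := fun t => X t ω - W t ω)
      (B := fun t => Y t ω - W t ω) (fun s => hb _ _) (fun s => hb _ _) h1 h2 hs hst

lemma max_drift_le (hbm : Measurable (Function.uncurry b)) (hb : ∀ u m, |b u m| ≤ C)
    (hmono : ∀ u, MonotoneOn (b u) (Ici u)) (hX : IsMaxDriftSolution P ℱ W b C x X)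
    (hY : IsMaxDriftSolution P ℱ W b C x Y) :
    ∀ᵐ ω ∂P, ∀ s t, 0 ≤ s → s ≤ t →
      max (X t ω) (Y t ω) - W t ω - (max (X s ω) (Y s ω) - W s ω)
      ≤ ∫ r in s..t, b (max (X r ω) (Y r ω)) (pathMax (fun s => max (X s ω) (Y s ω)) r) := by
  filter_upwards [hX.drift, hY.drift] with ω h1 h2 s t hs hst
  have hUc : Continuous fun s => max (X s ω) (Y s ω) := (hX.cont ω).max (hY.cont ω)
  rw [← max_sub_sub_right (X t ω), ← max_sub_sub_right (X s ω)]
  refine max_sub_max_le_integral (A := fun t => X t ω - W t ω)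
      (B := fun t => Y t ω - W t ω) (measurable_drift_path hbm (hX.cont ω))
      (measurable_drift_path hbm (hY.cont ω)) (measurable_drift_path hbm hUc)
      (fun s => hb _ _) (fun s => hb _ _) (fun s => hb _ _) h1 h2 ?_ ?_ hs hst
  · intro r hr hle
    have hle' : Y r ω ≤ X r ω := by simpa using hle
    have h3 : X r ω ≤ pathMax (fun s => X s ω) r := le_pathMax (hX.cont ω) hr le_rfl
    have h4 : pathMax (fun s => X s ω) r ≤ pathMax (fun s => max (X s ω) (Y s ω)) r :=
      pathMax_le hr fun u hu => (le_max_left _ _).trans (le_pathMax hUc hu.1 hu.2)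
    simp only [max_eq_left hle']
    exact hmono _ h3 (h3.trans h4) h4
  · intro r hr hle
    have hle' : X r ω ≤ Y r ω := by simpa using hle
    have h3 : Y r ω ≤ pathMax (fun s => Y s ω) r := le_pathMax (hY.cont ω) hr le_rfl
    have h4 : pathMax (fun s => Y s ω) r ≤ pathMax (fun s => max (X s ω) (Y s ω)) r :=
      pathMax_le hr fun u hu => (le_max_right _ _).trans (le_pathMax hUc hu.1 hu.2)
    simp only [max_eq_right hle']
    exact hmono _ h3 (h3.trans h4) h4

end IsMaxDriftSolution

lemma abs_clamp_sub_clamp_le (C a b : ℝ) :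
    |max (-C) (min C a) - max (-C) (min C b)| ≤ |a - b| := by
  refine (abs_max_sub_max_le_max _ _ _ _).trans (max_le (by simp) ?_)
  exact (abs_min_sub_min_le_max _ _ _ _).trans (max_le (by simp) le_rfl)

lemma IsStripBounded.exists_lipschitz_approx {C R : ℝ} {g : ℝ → ℝ → ℝ}
    (hg : IsStripBounded C R g) (ν : Measure (ℝ × ℝ)) [IsFiniteMeasure ν] {ε : ℝ} (hε : 0 < ε) :
    ∃ (f : ℝ → ℝ → ℝ) (L : ℝ), IsStripBounded C (R + 1) f ∧ IsPlaneLipschitz L f ∧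
      ∫⁻ q, ‖f q.1 q.2 - g q.1 q.2‖ₑ ∂ν ≤ ENNReal.ofReal ε := by
  have hC := hg.nonneg
  have hmem : MemLp (Function.uncurry g) 1 ν :=
    memLp_one_iff_integrable.2 ((integrable_const C).mono' hg.meas.aestronglyMeasurable
      (ae_of_all _ fun q => hg.bdd q.1 q.2))
  obtain ⟨f₀, hsupp, hsmooth, hclose⟩ := hmem.exist_eLpNorm_sub_le (by simp) le_rfl hε
  obtain ⟨K, hK⟩ := hsmooth.lipschitzWith_of_hasCompactSupport hsupp (by simp)
  have hK' : IsPlaneLipschitz K fun u m => f₀ (u, m) := fun u u' m m' => by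
    refine (hK.dist_le_mul (u, m) (u', m')).trans (mul_le_mul_of_nonneg_left ?_ K.2)
    exact max_le (le_add_of_nonneg_right (abs_nonneg _)) (le_add_of_nonneg_left (abs_nonneg _))
  set cl : ℝ → ℝ := fun a => max (-C) (min C a) with hcl
  have hcl_abs : ∀ a, |cl a| ≤ C := fun a =>
    abs_le.2 ⟨le_max_left _ _, max_le (by linarith) (min_le_left _ _)⟩
  have hcl_self : ∀ a, |a| ≤ C → cl a = a := fun a ha => by
    rw [abs_le] at ha
    rw [hcl]
    simp only
    rw [min_eq_right ha.2, max_eq_right ha.1]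
  have hcl_lip : IsPlaneLipschitz K fun u m => cl (f₀ (u, m)) := fun u u' m m' =>
    (abs_clamp_sub_clamp_le C _ _).trans (hK' u u' m m')
  set χ : ℝ → ℝ := fun u => max 0 (min 1 (R + 1 - |u|)) with hχ
  have hχ0 : ∀ u, 0 ≤ χ u := fun u => le_max_left _ _
  have hχ1 : ∀ u, |χ u| ≤ 1 := fun u => by
    rw [abs_of_nonneg (hχ0 u)]
    exact max_le zero_le_one (min_le_left _ _)
  have hχ_lip : IsPlaneLipschitz 1 fun u (_ : ℝ) => χ u := fun u u' m m' => by
    have h1 : |χ u - χ u'| ≤ |(R + 1 - |u|) - (R + 1 - |u'|)| :=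
      (abs_max_sub_max_le_max _ _ _ _).trans (max_le (by simp)
        ((abs_min_sub_min_le_max _ _ _ _).trans (max_le (by simp) le_rfl)))
    refine h1.trans ?_
    rw [sub_sub_sub_cancel_left, abs_sub_comm, one_mul]
    exact (abs_abs_sub_abs_le _ _).trans (le_add_of_nonneg_right (abs_nonneg _))
  have hlip := hχ_lip.mul hcl_lip (fun u _ => hχ1 u) (fun u m => hcl_abs (f₀ (u, m)))
  refine ⟨fun u m => χ u * cl (f₀ (u, m)), _, ⟨hlip.continuous.measurable, fun u m => ?_,
    fun u m hu => ?_⟩, hlip, ?_⟩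
  · rw [abs_mul]
    exact (mul_le_of_le_one_left (abs_nonneg _) (hχ1 u)).trans (hcl_abs _)
  · have : χ u = 0 := max_eq_left ((min_le_right _ _).trans (by linarith))
    rw [this, zero_mul]
  · rw [eLpNorm_sub_comm, eLpNorm_one_eq_lintegral_enorm] at hclose
    refine le_trans (lintegral_mono fun q => ?_) hclose
    rw [enorm_le_iff_norm_le, Real.norm_eq_abs, Pi.sub_apply, Real.norm_eq_abs]
    change |χ q.1 * cl (f₀ q) - g q.1 q.2| ≤ |f₀ q - g q.1 q.2|
    by_cases hq : |q.1| ≤ R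
    · have h1 : χ q.1 = 1 := by
        rw [hχ]
        simp only
        rw [min_eq_left (by linarith), max_eq_right zero_le_one]
      rw [h1, one_mul, ← hcl_self _ (hg.bdd q.1 q.2)]
      refine (abs_clamp_sub_clamp_le C _ _).trans (le_of_eq ?_)
      rw [hcl_self _ (hg.bdd q.1 q.2)]
    · rw [hg.supp _ _ (not_le.1 hq), sub_zero, sub_zero, abs_mul]
      refine (mul_le_of_le_one_left (abs_nonneg _) (hχ1 _)).trans ?_
      have := abs_clamp_sub_clamp_le C (f₀ q) 0
      have h0 := hcl_self 0 (by simpa using hC)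
      change |cl (f₀ q) - cl 0| ≤ _ at this
      rwa [h0, sub_zero, sub_zero] at this

/-- The expected occupation measure on `[0, T]` of a process and its running maximum. -/
noncomputable def occupationMeasure {Ω : Type*} {m : MeasurableSpace Ω} (P : Measure Ω)
    (Z : ℝ → Ω → ℝ) (T : ℝ) : Measure (ℝ × ℝ) :=
  ((volume.restrict (Ioc 0 T)).prod P).map
    fun q : ℝ × Ω => (Z q.1 q.2, pathMax (fun s => Z s q.2) q.1)

instance {Ω : Type*} {m : MeasurableSpace Ω} (P : Measure Ω) [IsFiniteMeasure P]
    (Z : ℝ → Ω → ℝ) (T : ℝ) : IsFiniteMeasure (occupationMeasure P Z T) := by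
  unfold occupationMeasure
  infer_instance

namespace IsDriftedBrownian

variable {Ω : Type*} {m : MeasurableSpace Ω} {P : Measure Ω} [IsProbabilityMeasure P]
  {ℱ : Filtration ℝ m} {W Z : ℝ → Ω → ℝ} {C S L x T : ℝ} {f g : ℝ → ℝ → ℝ}

lemma integral_occupationMeasure (hZ : IsDriftedBrownian P ℱ W C x Z) {φ : ℝ × ℝ → ℝ}
    (hφ : Measurable φ) {K : ℝ} (hφK : ∀ q, |φ q| ≤ K) (hT : 0 ≤ T) :
    ∫ q, φ q ∂occupationMeasure P Z T
      = ∫ ω, (∫ s in (0 : ℝ)..T, φ (Z s ω, pathMax (fun s => Z s ω) s)) ∂P := by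
  have hi : Integrable (fun q : ℝ × Ω => φ (Z q.1 q.2, pathMax (fun s => Z s q.2) q.1))
      ((volume.restrict (Ioc 0 T)).prod P) := (integrable_const K).mono'
    (hφ.comp hZ.measurable_pair).aestronglyMeasurable (ae_of_all _ fun q => hφK _)
  rw [occupationMeasure, integral_map hZ.measurable_pair.aemeasurable hφ.aestronglyMeasurable,
    integral_prod_symm _ hi]
  simp only [intervalIntegral.integral_of_le hT]

lemma integrable_maxHarmonic (hZ : IsDriftedBrownian P ℱ W C x Z)
    (hW : IsStandardBrownianMotion P ℱ W) (hf : IsStripBounded C S f) (hS : 0 ≤ S)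
    (hL : IsPlaneLipschitz L f) (hT : 0 < T) :
    Integrable (fun ω => maxHarmonic f x (Z T ω) (pathMax (fun s => Z s ω) T)) P := by
  refine (((((integrable_const |x|).add (hZ.integrable hW hT.le).abs).add
      ((hZ.integrable_pathMax hW hf.nonneg hT).abs.const_mul 2)).const_mul
      (Real.exp (4 * C * S)))).mono' ?_ (ae_of_all _ fun ω => hf.abs_maxHarmonic_le hS x _ _)
  exact ((hf.continuous_maxHarmonic hS hL x).measurable.comp
    ((hZ.measurable T).prodMk (hZ.measurable_pathMax T))).aestronglyMeasurable

lemma integral_maxHarmonic_le_occupation (hZ : IsDriftedBrownian P ℱ W C x Z)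
    (hW : IsStandardBrownianMotion P ℱ W) (hf : IsStripBounded C S f) (hS : 0 ≤ S)
    (hL : IsPlaneLipschitz L f) (hg : Measurable (Function.uncurry g))
    (hgC : ∀ u m, |g u m| ≤ C) {σ : ℝ} (hσ : |σ| ≤ 1)
    (hdrift : ∀ᵐ ω ∂P, ∀ s t, 0 ≤ s → s ≤ t → σ * (Z t ω - W t ω - (Z s ω - W s ω))
      ≤ σ * ∫ r in s..t, g (Z r ω) (pathMax (fun s => Z s ω) r)) (hT : 0 < T) :
    σ * ∫ ω, maxHarmonic f x (Z T ω) (pathMax (fun s => Z s ω) T) ∂P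
      ≤ Real.exp (4 * C * S) * ∫ q, |g q.1 q.2 - f q.1 q.2| ∂occupationMeasure P Z T := by
  have hC := hf.nonneg
  set B := Real.exp (4 * C * S) with hB
  have hB0 : 0 < B := Real.exp_pos _
  have hφ : Measurable fun q : ℝ × ℝ => |g q.1 q.2 - f q.1 q.2| :=
    measurable_norm.comp (hg.sub hf.meas)
  have hφK : ∀ q : ℝ × ℝ, |(|g q.1 q.2 - f q.1 q.2|)| ≤ C + C := fun q => by
    rw [abs_abs]
    exact (abs_sub _ _).trans (add_le_add (hgC _ _) (hf.bdd _ _))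
  rw [hZ.integral_occupationMeasure hφ hφK hT.le]
  set D : Ω → ℝ := fun ω => ∫ s in (0 : ℝ)..T, |g (Z s ω) (pathMax (fun s => Z s ω) s)
    - f (Z s ω) (pathMax (fun s => Z s ω) s)| with hD
  have hDi : Integrable D P := by
    refine (integrable_const ((C + C) * (T - 0))).mono' (measurable_intervalIntegral
      (hφ.comp hZ.measurable_pair) 0 T).aestronglyMeasurable (ae_of_all _ fun ω => ?_)
    exact abs_intervalIntegral_le (fun s => hφK (Z s ω, pathMax (fun s => Z s ω) s)) hT.le
  have hH := (hZ.integrable_maxHarmonic hW hf hS hL hT).const_mul σ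
  have hpath : ∀ ω, |(∫ s in (0 : ℝ)..T, scaleDensity f (Z s ω) (pathMax (fun s => Z s ω) s)
            * g (Z s ω) (pathMax (fun s => Z s ω) s))
          - ∫ s in (0 : ℝ)..T, f (Z s ω) (pathMax (fun s => Z s ω) s)
            * scaleDensity f (Z s ω) (pathMax (fun s => Z s ω) s) * 1| ≤ B * D ω := by
    intro ω
    have hmeas : Measurable fun s => (Z s ω, pathMax (fun s => Z s ω) s) :=
      hZ.measurable_pair.comp (measurable_id.prodMk measurable_const)
    have hp : ∀ u v, |scaleDensity f u v| ≤ B := fun u v => by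
      rw [abs_of_pos (scaleDensity_pos f u v)]
      exact hf.scaleDensity_le hS u v
    have hpm := hf.measurable_scaleDensity.comp hmeas
    have i1 : IntervalIntegrable (fun s => scaleDensity f (Z s ω) (pathMax (fun s => Z s ω) s)
        * g (Z s ω) (pathMax (fun s => Z s ω) s)) volume 0 T :=
      intervalIntegrable_of_abs_le (C := B * C) (hpm.mul (hg.comp hmeas)) (fun s => by
        refine (abs_mul _ _).trans_le ?_
        exact mul_le_mul (hp _ _) (hgC _ _) (abs_nonneg _) hB0.le) 0 T
    have i2 : IntervalIntegrable (fun s => f (Z s ω) (pathMax (fun s => Z s ω) s)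
        * scaleDensity f (Z s ω) (pathMax (fun s => Z s ω) s)) volume 0 T :=
      intervalIntegrable_of_abs_le (C := C * B) ((hf.meas.comp hmeas).mul hpm)
      (fun s => by
      refine (abs_mul _ _).trans_le ?_
      exact mul_le_mul (hf.bdd _ _) (hp _ _) (abs_nonneg _) hC) 0 T
    have i3 : IntervalIntegrable (fun s => |g (Z s ω) (pathMax (fun s => Z s ω) s)
        - f (Z s ω) (pathMax (fun s => Z s ω) s)|) volume 0 T :=
      intervalIntegrable_of_abs_le (hφ.comp hmeas) (fun s => hφK _) 0 T
    simp only [mul_one]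
    rw [← intervalIntegral.integral_sub i1 i2, hD, ← intervalIntegral.integral_const_mul]
    refine (intervalIntegral.abs_integral_le_integral_abs hT.le).trans
      (intervalIntegral.integral_mono_on hT.le (i1.sub i2).abs (i3.const_mul B) fun s _ => ?_)
    rw [mul_comm (f _ _), ← mul_sub, abs_mul]
    exact mul_le_mul_of_nonneg_right (hp _ _) (abs_nonneg _)
  have hmain := hZ.integral_maxHarmonic_le hW hf hS hL hg hgC hσ hdrift hT
  set Φ : Ω → ℝ := fun ω => σ * (maxHarmonic f x (Z T ω) (pathMax (fun s => Z s ω) T)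
        - ((∫ s in (0 : ℝ)..T, scaleDensity f (Z s ω) (pathMax (fun s => Z s ω) s)
            * g (Z s ω) (pathMax (fun s => Z s ω) s))
          - ∫ s in (0 : ℝ)..T, f (Z s ω) (pathMax (fun s => Z s ω) s)
            * scaleDensity f (Z s ω) (pathMax (fun s => Z s ω) s) * 1)) with hΦ
  have hclose : ∀ ω, |σ * maxHarmonic f x (Z T ω) (pathMax (fun s => Z s ω) T) - Φ ω|
      ≤ B * D ω := fun ω => by
    rw [hΦ]
    simp only
    rw [← mul_sub, sub_sub_cancel, abs_mul]
    exact (mul_le_of_le_one_left (abs_nonneg _) hσ).trans (hpath ω)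
  have hΦm : AEStronglyMeasurable Φ P := aestronglyMeasurable_of_tendsto_ae Filter.atTop
    (fun n => (hZ.measurable_gridValue hf hS hL hg σ hT n).aestronglyMeasurable)
    (ae_of_all _ fun ω => hZ.tendsto_gridValue hf hS hL hg hgC σ hT ω)
  have hΦi : Integrable Φ P := by
    refine (hH.abs.add (hDi.const_mul B)).mono' hΦm (ae_of_all _ fun ω => ?_)
    have h1 := abs_le.1 (hclose ω)
    have h2 := abs_le.1 (le_refl |σ * maxHarmonic f x (Z T ω) (pathMax (fun s => Z s ω) T)|)
    change |Φ ω| ≤ |σ * maxHarmonic f x (Z T ω) (pathMax (fun s => Z s ω) T)| + B * D ω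
    rw [abs_le]
    constructor <;> linarith [h1.1, h1.2, h2.1, h2.2]
  rw [← integral_const_mul, ← integral_const_mul]
  have h3 := integral_mono hH (hΦi.add (hDi.const_mul B)) fun ω => by
    have h1 := (abs_le.1 (hclose ω)).2
    change _ ≤ Φ ω + B * D ω
    linarith
  rw [integral_add' hΦi (hDi.const_mul B)] at h3
  refine h3.trans ?_
  have h4 : ∫ ω, Φ ω ∂P ≤ 0 := hmain
  exact add_le_of_nonpos_left h4

/-- The expected exponential moments of a drifted Brownian motion give exponential tails of its
occupation measure. -/
lemma exists_occupationMeasure_tail (hZ : IsDriftedBrownian P ℱ W C x Z)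
    (hW : IsStandardBrownianMotion P ℱ W) (hC : 0 ≤ C) {l : ℝ} (hl : 0 ≤ l) (hT : 0 < T) :
    ∃ K : ℝ, ∀ R : ℝ, (occupationMeasure P Z T).real {q | R < |q.1|} ≤ K * Real.exp (-l * R) := by
  have hset : ∀ R : ℝ, MeasurableSet {q : ℝ × ℝ | R < |q.1|} := fun R =>
    measurableSet_lt measurable_const (measurable_norm.comp measurable_fst)
  set E := 2 * (Real.exp (l * (|x| + C * T)) * Real.exp (l ^ 2 * T / 2)) with hE
  refine ⟨E * T, fun R => ?_⟩
  have hexp : ∀ s, 0 ≤ s → ∀ c : ℝ, |c| = l → Integrable (fun ω => Real.exp (c * W s ω)) P ∧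
      ∫ ω, Real.exp (c * W s ω) ∂P = Real.exp (l ^ 2 * s / 2) := by
    intro s hs c hc
    have hmap : P.map (W s) = gaussianReal 0 (Real.toNNReal s) := by
      have := hW.2.2.2.2 0 s le_rfl hs
      simpa [hW.2.1] using this
    have hWm : AEMeasurable (W s) P := (hW.measurable s).aemeasurable
    constructor
    · have := integrable_exp_mul_gaussianReal (μ := 0) (v := Real.toNNReal s) c
      rw [← hmap] at this
      exact (integrable_map_measure (by fun_prop) hWm).1 this
    · have := mgf_gaussianReal hmap c
      rw [mgf] at this
      rw [this, zero_mul, zero_add, Real.coe_toNNReal s hs, ← sq_abs c, hc]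
      ring_nf
  have hprob : ∀ s ∈ Ioc 0 T, P.real {ω | R < |Z s ω|} ≤ E * Real.exp (-l * R) := by
    intro s hs
    obtain ⟨ip, hp⟩ := hexp s hs.1.le l (abs_of_nonneg hl)
    obtain ⟨im, hm⟩ := hexp s hs.1.le (-l) (by rw [abs_neg, abs_of_nonneg hl])
    have hmeas : MeasurableSet {ω | R < |Z s ω|} :=
      measurableSet_lt measurable_const (measurable_norm.comp (hZ.measurable s))
    rw [← integral_indicator_one hmeas]
    have hle : ∫ ω, {ω | R < |Z s ω|}.indicator 1 ω ∂P
        ≤ ∫ ω, Real.exp (l * (|x| + C * T) - l * R)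
          * (Real.exp (l * W s ω) + Real.exp (-l * W s ω)) ∂P := by
      refine integral_mono_ae ((integrable_const (1 : ℝ)).indicator hmeas)
        ((ip.add im).const_mul _) ?_
      filter_upwards [hZ.abs_sub_le hW] with ω hω
      by_cases h : R < |Z s ω|
      · rw [indicator_of_mem (show ω ∈ {ω | R < |Z s ω|} from h), Pi.one_apply]
        have h1 := hω s hs.1.le
        have h2 : |Z s ω| ≤ |x| + C * T + |W s ω| := by
          have h3 : Z s ω = (Z s ω - x - W s ω) + x + W s ω := by ring
          have h4 : C * s ≤ C * T := mul_le_mul_of_nonneg_left hs.2 hC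
          rw [h3]
          refine (abs_add_three _ _ _).trans ?_
          linarith
        have h3 : Real.exp (l * |W s ω|) ≤ Real.exp (l * W s ω) + Real.exp (-l * W s ω) := by
          rcases abs_cases (W s ω) with ⟨h, _⟩ | ⟨h, _⟩
          · rw [h]
            exact le_add_of_nonneg_right (Real.exp_pos _).le
          · rw [h, mul_neg, ← neg_mul]
            exact le_add_of_nonneg_left (Real.exp_pos _).le
        refine le_trans ?_ (mul_le_mul_of_nonneg_left h3 (Real.exp_pos _).le)
        rw [← Real.exp_add, Real.one_le_exp_iff]
        nlinarith
      · rw [indicator_of_notMem (show ω ∉ {ω | R < |Z s ω|} from h)]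
        positivity
    refine hle.trans ?_
    rw [integral_const_mul, integral_add ip im, hp, hm, hE, sub_eq_add_neg, Real.exp_add,
      ← neg_mul]
    have h1 : Real.exp (l ^ 2 * s / 2) ≤ Real.exp (l ^ 2 * T / 2) :=
      Real.exp_le_exp.2 (by have := mul_le_mul_of_nonneg_left hs.2 (sq_nonneg l); linarith)
    have h2 : 0 ≤ Real.exp (l * (|x| + C * T)) * Real.exp (-l * R) := by positivity
    nlinarith [mul_le_mul_of_nonneg_left h1 h2]
  have hpre : MeasurableSet ((fun q : ℝ × Ω => (Z q.1 q.2, pathMax (fun s => Z s q.2) q.1)) ⁻¹'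
      {q | R < |q.1|}) := hZ.measurable_pair (hset R)
  have hT' : (volume.restrict (Ioc 0 T)) univ = ENNReal.ofReal T := by simp
  rw [Measure.real]
  refine ENNReal.toReal_le_of_le_ofReal (by positivity) ?_
  rw [occupationMeasure, Measure.map_apply hZ.measurable_pair (hset R), Measure.prod_apply hpre]
  calc _ ≤ ∫⁻ _ in Ioc 0 T, ENNReal.ofReal (E * Real.exp (-l * R)) := by
        refine setLIntegral_mono measurable_const fun s hs => ?_
        have := hprob s hs
        rw [ENNReal.le_ofReal_iff_toReal_le (measure_ne_top _ _) (by positivity)]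
        exact this
    _ = ENNReal.ofReal (E * T * Real.exp (-l * R)) := by
        rw [lintegral_const, hT', ← ENNReal.ofReal_mul (by positivity)]
        ring_nf

end IsDriftedBrownian

lemma IsStripBounded.mono {C S S' : ℝ} {g : ℝ → ℝ → ℝ} (hg : IsStripBounded C S g) (hS : S ≤ S') :
    IsStripBounded C S' g :=
  ⟨hg.meas, hg.bdd, fun u m hu => hg.supp u m (hS.trans_lt hu)⟩

/-- The error term in `IsStripBounded.enorm_maxHarmonic_sub_le`. -/
noncomputable def boundaryError (S x z m : ℝ) (φ : ℝ × ℝ → ENNReal) : ENNReal :=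
  (∫⁻ v in Ioc x m, ∫⁻ u in Icc (-S) S, φ (u, v))
    + ENNReal.ofReal (m - z) * ∫⁻ u in Icc (-S) S, φ (u, m)

section boundaryError

variable {Ω : Type*} {m : MeasurableSpace Ω} {P : Measure Ω} {Z M : Ω → ℝ} {φ : ℝ × ℝ → ENNReal}

lemma measurable_lintegral_Ioc (x : ℝ) (hM : Measurable M) {ψ : ℝ → ENNReal} (hψ : Measurable ψ) :
    Measurable fun ω => ∫⁻ v in Ioc x (M ω), ψ v := by
  have hA : MeasurableSet {q : Ω × ℝ | x < q.2 ∧ q.2 ≤ M q.1} :=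
    (measurableSet_lt measurable_const measurable_snd).inter
      (measurableSet_le measurable_snd (hM.comp measurable_fst))
  have h := ((hψ.comp measurable_snd).indicator hA).lintegral_prod_right' (ν := volume)
  convert h using 2 with ω
  rw [← lintegral_indicator measurableSet_Ioc]
  rfl

lemma measurable_boundaryError (S x : ℝ) (hZ : Measurable Z) (hM : Measurable M)
    (hφ : Measurable φ) : Measurable fun ω => boundaryError S x (Z ω) (M ω) φ := by
  have hψ : Measurable fun v => ∫⁻ u in Icc (-S) S, φ (u, v) := hφ.lintegral_prod_left'
  exact (measurable_lintegral_Ioc x hM hψ).add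
    ((hM.sub hZ).ennreal_ofReal.mul (hψ.comp hM))

lemma exists_measure_lintegral_boundaryError_le [IsFiniteMeasure P] (S x : ℝ) (hZ : Measurable Z)
    (hM : Measurable M) (hZi : Integrable Z P) (hMi : Integrable M P) :
    ∃ ν : Measure (ℝ × ℝ), IsFiniteMeasure ν ∧ ∀ φ : ℝ × ℝ → ENNReal, Measurable φ →
      ∫⁻ ω, boundaryError S x (Z ω) (M ω) φ ∂P ≤ ∫⁻ q, φ q ∂ν := by
  set A : Set (Ω × ℝ) := {q | x < q.2 ∧ q.2 ≤ M q.1} with hA_def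
  have hA : MeasurableSet A :=
    (measurableSet_lt measurable_const measurable_snd).inter
      (measurableSet_le measurable_snd (hM.comp measurable_fst))
  set ν₁ : Measure ℝ := ((P.prod volume).restrict A).map Prod.snd with hν₁
  set ν₂ : Measure ℝ := (P.withDensity fun ω => ENNReal.ofReal (M ω - Z ω)).map M with hν₂
  have h1 : ∀ ψ : ℝ → ENNReal, Measurable ψ →
      ∫⁻ v, ψ v ∂ν₁ = ∫⁻ ω, (∫⁻ v in Ioc x (M ω), ψ v) ∂P := by
    intro ψ hψ
    have hc : Measurable fun q : Ω × ℝ => ψ q.2 := hψ.comp measurable_snd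
    rw [hν₁, lintegral_map hψ measurable_snd, ← lintegral_indicator hA,
      lintegral_prod _ (hc.indicator hA).aemeasurable]
    refine lintegral_congr fun ω => ?_
    rw [← lintegral_indicator measurableSet_Ioc]
    rfl
  have h2 : ∀ ψ : ℝ → ENNReal, Measurable ψ →
      ∫⁻ v, ψ v ∂ν₂ = ∫⁻ ω, ENNReal.ofReal (M ω - Z ω) * ψ (M ω) ∂P := by
    intro ψ hψ
    have hd : Measurable fun ω => ENNReal.ofReal (M ω - Z ω) := (hM.sub hZ).ennreal_ofReal
    have hc : Measurable fun ω => ψ (M ω) := hψ.comp hM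
    rw [hν₂, lintegral_map hψ hM, lintegral_withDensity_eq_lintegral_mul _ hd hc]
    rfl
  have f1 : IsFiniteMeasure ν₁ := by
    refine ⟨?_⟩
    rw [← lintegral_one, h1 _ measurable_const]
    simp only [lintegral_const, one_mul, Measure.restrict_apply_univ, Real.volume_Ioc]
    exact (hMi.sub (integrable_const x)).lintegral_lt_top
  have f2 : IsFiniteMeasure ν₂ := by
    refine ⟨?_⟩
    rw [← lintegral_one, h2 _ measurable_const]
    simp only [mul_one]
    exact (hMi.sub hZi).lintegral_lt_top
  refine ⟨(volume.restrict (Icc (-S) S)).prod (ν₁ + ν₂), ?_, fun φ hφ => ?_⟩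
  · have : IsFiniteMeasure (volume.restrict (Icc (-S) S)) := ⟨by simp⟩
    infer_instance
  · have hψ : Measurable fun v => ∫⁻ u in Icc (-S) S, φ (u, v) := hφ.lintegral_prod_left'
    rw [lintegral_prod_symm _ hφ.aemeasurable, lintegral_add_measure, h1 _ hψ, h2 _ hψ]
    unfold boundaryError
    rw [lintegral_add_left (measurable_lintegral_Ioc x hM hψ)]

end boundaryError

lemma integral_le_of_lintegral_ofReal_le {Ω : Type*} {m : MeasurableSpace Ω} {P : Measure Ω}
    {Y : Ω → ℝ} (hY : Integrable Y P) {c : ℝ} (hc : 0 ≤ c)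
    (h : ∫⁻ ω, ENNReal.ofReal (Y ω) ∂P ≤ ENNReal.ofReal c) : ∫ ω, Y ω ∂P ≤ c := by
  rw [integral_eq_lintegral_pos_part_sub_lintegral_neg_part hY]
  have h1 := ENNReal.toReal_le_of_le_ofReal hc h
  have h2 : 0 ≤ (∫⁻ ω, ENNReal.ofReal (-Y ω) ∂P).toReal := ENNReal.toReal_nonneg
  linarith

/-- The drift cut off outside the strip `|u| ≤ R`. -/
noncomputable def stripCutoff (R : ℝ) (b : ℝ → ℝ → ℝ) (u m : ℝ) : ℝ := if |u| ≤ R then b u m else 0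

lemma isStripBounded_stripCutoff {C : ℝ} {b : ℝ → ℝ → ℝ} (hb : Measurable (Function.uncurry b))
    (hbC : ∀ u m, |b u m| ≤ C) (R : ℝ) : IsStripBounded C R (stripCutoff R b) where
  meas := Measurable.ite
    (measurableSet_le (measurable_norm.comp measurable_fst) measurable_const) hb measurable_const
  bdd u m := by
    unfold stripCutoff
    split_ifs
    · exact hbC u m
    · simpa using (abs_nonneg _).trans (hbC u m)
  supp u m hu := if_neg (not_le.2 hu)

lemma monotoneOn_stripCutoff {b : ℝ → ℝ → ℝ} (hb : ∀ u, MonotoneOn (b u) (Ici u)) (R u : ℝ) :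
    MonotoneOn (stripCutoff R b u) (Ici u) := by
  unfold stripCutoff
  split_ifs
  · exact hb u
  · exact monotoneOn_const

namespace IsDriftedBrownian

variable {Ω : Type*} {m : MeasurableSpace Ω} {P : Measure Ω} [IsProbabilityMeasure P]
  {ℱ : Filtration ℝ m} {W X U : ℝ → Ω → ℝ} {C x T : ℝ} {b f : ℝ → ℝ → ℝ}

lemma integral_occupation_sub_le {Z : ℝ → Ω → ℝ} {R S ε : ℝ}
    (hb : Measurable (Function.uncurry b))
    (hbC : ∀ u m, |b u m| ≤ C) (hf : IsStripBounded C S f) (hε : 0 ≤ ε)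
    (happrox : ∫⁻ q, ‖f q.1 q.2 - stripCutoff R b q.1 q.2‖ₑ ∂occupationMeasure P Z T
      ≤ ENNReal.ofReal ε) :
    ∫ q, |b q.1 q.2 - f q.1 q.2| ∂occupationMeasure P Z T
      ≤ ε + C * (occupationMeasure P Z T).real {q | R < |q.1|} := by
  have hcut := isStripBounded_stripCutoff hb hbC R
  have hset : MeasurableSet {q : ℝ × ℝ | R < |q.1|} :=
    measurableSet_lt measurable_const (measurable_norm.comp measurable_fst)
  have hi1 : Integrable (fun q : ℝ × ℝ => f q.1 q.2 - stripCutoff R b q.1 q.2)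
      (occupationMeasure P Z T) :=
    (integrable_const (C + C)).mono' (hf.meas.sub hcut.meas).aestronglyMeasurable
      (ae_of_all _ fun q => (abs_sub _ _).trans (add_le_add (hf.bdd _ _) (hcut.bdd _ _)))
  have hi2 : Integrable (fun q : ℝ × ℝ => b q.1 q.2 - f q.1 q.2) (occupationMeasure P Z T) :=
    (integrable_const (C + C)).mono' (hb.sub hf.meas).aestronglyMeasurable
      (ae_of_all _ fun q => (abs_sub _ _).trans (add_le_add (hbC _ _) (hf.bdd _ _)))
  have hi3 : Integrable ({q : ℝ × ℝ | R < |q.1|}.indicator fun _ => C)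
      (occupationMeasure P Z T) := (integrable_const C).indicator hset
  have h1 := integral_mono hi2.abs (hi1.abs.add hi3) fun q => by
    change |b q.1 q.2 - f q.1 q.2| ≤ |f q.1 q.2 - stripCutoff R b q.1 q.2|
      + {q : ℝ × ℝ | R < |q.1|}.indicator (fun _ => C) q
    by_cases hq : R < |q.1|
    · rw [indicator_of_mem (show q ∈ {q : ℝ × ℝ | R < |q.1|} from hq), hcut.supp _ _ hq, sub_zero]
      exact (abs_sub _ _).trans (by linarith [hbC q.1 q.2])
    · rw [indicator_of_notMem (show q ∉ {q : ℝ × ℝ | R < |q.1|} from hq), add_zero, stripCutoff,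
        if_pos (not_lt.1 hq), abs_sub_comm]
  rw [integral_add' hi1.abs hi3, integral_indicator_const C hset, smul_eq_mul] at h1
  have h2 : ∫ q, |f q.1 q.2 - stripCutoff R b q.1 q.2| ∂occupationMeasure P Z T ≤ ε := by
    have := integral_norm_eq_lintegral_enorm hi1.aestronglyMeasurable
    simp only [Real.norm_eq_abs] at this
    rw [this]
    exact ENNReal.toReal_le_of_le_ofReal hε happrox
  linarith

/-- Comparison between a solution `X` and a drifted Brownian motion `U ≥ X` whose drift is at most
that of the equation. -/
lemma integral_sub_le_occupation_tail (hU : IsDriftedBrownian P ℱ W C x U)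
    (hX : IsMaxDriftSolution P ℱ W b C x X) (hW : IsStandardBrownianMotion P ℱ W)
    (hb : Measurable (Function.uncurry b)) (hbC : ∀ u m, |b u m| ≤ C)
    (hmono : ∀ u, MonotoneOn (b u) (Ici u))
    (hUd : ∀ᵐ ω ∂P, ∀ s t, 0 ≤ s → s ≤ t → U t ω - W t ω - (U s ω - W s ω)
      ≤ ∫ r in s..t, b (U r ω) (pathMax (fun s => U s ω) r))
    (hXU : ∀ t ω, X t ω ≤ U t ω) (hT : 0 < T) {R : ℝ} (hR : 0 ≤ R) :
    ∫ ω, (U T ω - X T ω) ∂P ≤ Real.exp (4 * C * (R + 1)) ^ 2 * C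
      * ((occupationMeasure P U T).real {q | R < |q.1|}
        + (occupationMeasure P X T).real {q | R < |q.1|}) := by
  have hC : 0 ≤ C := (abs_nonneg _).trans (hbC 0 0)
  have hS : 0 ≤ R + 1 := by linarith
  have hX' := hX.toIsDriftedBrownian
  set B := Real.exp (4 * C * (R + 1)) with hB
  have hB0 : 0 < B := Real.exp_pos _
  set tU := (occupationMeasure P U T).real {q | R < |q.1|}
  set tX := (occupationMeasure P X T).real {q | R < |q.1|}
  set g := stripCutoff R b with hg_def
  have hg : IsStripBounded C R g := isStripBounded_stripCutoff hb hbC R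
  have hg' : IsStripBounded C (R + 1) g := hg.mono (by linarith)
  obtain ⟨νU, fU, hνU⟩ := exists_measure_lintegral_boundaryError_le (R + 1) x (hU.measurable T)
    (hU.measurable_pathMax T) (hU.integrable hW hT.le) (hU.integrable_pathMax hW hC hT)
  obtain ⟨νX, fX, hνX⟩ := exists_measure_lintegral_boundaryError_le (R + 1) x (hX'.measurable T)
    (hX'.measurable_pathMax T) (hX'.integrable hW hT.le) (hX'.integrable_pathMax hW hC hT)
  suffices h : ∀ ε : ℝ, 0 < ε → ∫ ω, (U T ω - X T ω) ∂P ≤ B ^ 2 * C * (tU + tX) + B ^ 2 * 6 * ε by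
    refine le_of_forall_pos_le_add fun ε hε => ?_
    have := h (ε / (B ^ 2 * 6)) (by positivity)
    rwa [mul_div_cancel₀ _ (by positivity)] at this
  intro ε hε
  obtain ⟨f, L, hf, hL, hclose⟩ := hg.exists_lipschitz_approx
    (occupationMeasure P U T + occupationMeasure P X T + νU + νX) hε
  simp only [lintegral_add_measure] at hclose
  set φ : ℝ × ℝ → ENNReal := fun q => ‖f q.1 q.2 - g q.1 q.2‖ₑ with hφ
  have hφm : Measurable φ := (hf.meas.sub hg.meas).enorm
  have c1 : ∫⁻ q, φ q ∂occupationMeasure P U T ≤ ENNReal.ofReal ε :=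
    le_trans (by rw [add_assoc, add_assoc]; exact le_self_add) hclose
  have c2 : ∫⁻ q, φ q ∂occupationMeasure P X T ≤ ENNReal.ofReal ε :=
    le_trans (le_add_right (le_add_right le_add_self)) hclose
  have c3 : ∫⁻ q, φ q ∂νU ≤ ENNReal.ofReal ε := le_trans (le_add_right le_add_self) hclose
  have c4 : ∫⁻ q, φ q ∂νX ≤ ENNReal.ofReal ε := le_trans le_add_self hclose
  have hΛU := integral_occupation_sub_le hb hbC hf hε.le c1
  have hΛX := integral_occupation_sub_le hb hbC hf hε.le c2
  have hEU := hU.integral_maxHarmonic_le_occupation hW hf hS hL hb hbC (σ := 1) (by simp)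
    (by simpa only [one_mul] using hUd) hT
  have hEX := hX'.integral_maxHarmonic_le_occupation hW hf hS hL hb hbC (σ := -1) (by simp)
    (by
      filter_upwards [hX.drift] with ω h s t hs hst
      rw [h s t hs hst]) hT
  have hiU := hU.integrable_maxHarmonic hW hf hS hL hT
  have hiX := hX'.integrable_maxHarmonic hW hf hS hL hT
  have hiD : Integrable (fun ω => U T ω - X T ω) P :=
    (hU.integrable hW hT.le).sub (hX'.integrable hW hT.le)
  set HU : Ω → ℝ := fun ω => maxHarmonic f x (U T ω) (pathMax (fun s => U s ω) T)
  set HX : Ω → ℝ := fun ω => maxHarmonic f x (X T ω) (pathMax (fun s => X s ω) T)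
  have hY : Integrable (fun ω => B⁻¹ * (U T ω - X T ω) - (HU ω - HX ω)) P :=
    (hiD.const_mul _).sub (hiU.sub hiX)
  have hmain : ∫ ω, (B⁻¹ * (U T ω - X T ω) - (HU ω - HX ω)) ∂P ≤ 2 * B * (ε + ε) := by
    refine integral_le_of_lintegral_ofReal_le hY (by positivity) ?_
    have hpt : ∀ᵐ ω ∂P, ENNReal.ofReal (B⁻¹ * (U T ω - X T ω) - (HU ω - HX ω))
        ≤ ENNReal.ofReal (2 * B)
          * (boundaryError (R + 1) x (U T ω) (pathMax (fun s => U s ω) T) φ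
            + boundaryError (R + 1) x (X T ω) (pathMax (fun s => X s ω) T) φ) := by
      filter_upwards [hU.le_pathMax, hX'.le_pathMax] with ω hxU hxX
      have hXm : X T ω ≤ pathMax (fun s => X s ω) T := _root_.le_pathMax (hX.cont ω) hT.le le_rfl
      have hUm : U T ω ≤ pathMax (fun s => U s ω) T := _root_.le_pathMax (hU.cont ω) hT.le le_rfl
      have hMM : pathMax (fun s => X s ω) T ≤ pathMax (fun s => U s ω) T :=
        pathMax_le hT.le fun u hu => (hXU u ω).trans (_root_.le_pathMax (hU.cont ω) hu.1 hu.2)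
      have h1 := hg'.mul_sub_le_maxHarmonic_sub hS (monotoneOn_stripCutoff hmono R) (x := x)
        (hXU T ω) hMM hXm
      have h2 := hf.enorm_maxHarmonic_sub_le hg' hS (hxU T hT.le) hUm
      have h3 := hf.enorm_maxHarmonic_sub_le hg' hS (hxX T hT.le) hXm
      rw [mul_add]
      refine le_trans ?_ (add_le_add h2 h3)
      rw [Real.enorm_eq_ofReal_abs, Real.enorm_eq_ofReal_abs,
        ← ENNReal.ofReal_add (abs_nonneg _) (abs_nonneg _)]
      refine ENNReal.ofReal_le_ofReal ?_
      have h4 := neg_abs_le (maxHarmonic f x (U T ω) (pathMax (fun s => U s ω) T)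
        - maxHarmonic g x (U T ω) (pathMax (fun s => U s ω) T))
      have h5 := le_abs_self (maxHarmonic f x (X T ω) (pathMax (fun s => X s ω) T)
        - maxHarmonic g x (X T ω) (pathMax (fun s => X s ω) T))
      change B⁻¹ * (U T ω - X T ω) - (maxHarmonic f x (U T ω) (pathMax (fun s => U s ω) T)
        - maxHarmonic f x (X T ω) (pathMax (fun s => X s ω) T)) ≤ _
      linarith
    refine (lintegral_mono_ae hpt).trans ?_
    have mU := measurable_boundaryError (R + 1) x (hU.measurable T) (hU.measurable_pathMax T) hφm
    have mX := measurable_boundaryError (R + 1) x (hX'.measurable T) (hX'.measurable_pathMax T) hφm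
    have mUX : Measurable fun ω =>
        boundaryError (R + 1) x (U T ω) (pathMax (fun s => U s ω) T) φ
          + boundaryError (R + 1) x (X T ω) (pathMax (fun s => X s ω) T) φ := mU.add mX
    rw [lintegral_const_mul _ mUX, lintegral_add_left mU,
      ENNReal.ofReal_mul (by positivity : 0 ≤ 2 * B), ENNReal.ofReal_add hε.le hε.le]
    gcongr
    · exact (hνU φ hφm).trans c3
    · exact (hνX φ hφm).trans c4
  have hiH : Integrable (fun ω => HU ω - HX ω) P := hiU.sub hiX
  rw [integral_sub (hiD.const_mul _) hiH, integral_const_mul, integral_sub hiU hiX] at hmain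
  rw [← hB] at hEU hEX
  have h1 := mul_le_mul_of_nonneg_left hΛU hB0.le
  have h2 := mul_le_mul_of_nonneg_left hΛX hB0.le
  have h3 : B⁻¹ * ∫ ω, (U T ω - X T ω) ∂P ≤ 4 * B * ε + B * (2 * ε + C * (tU + tX)) := by linarith
  have h4 := mul_le_mul_of_nonneg_left h3 hB0.le
  rw [mul_inv_cancel_left₀ hB0.ne'] at h4
  linarith

lemma integral_sub_nonpos (hU : IsDriftedBrownian P ℱ W C x U)
    (hX : IsMaxDriftSolution P ℱ W b C x X) (hW : IsStandardBrownianMotion P ℱ W)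
    (hb : Measurable (Function.uncurry b)) (hbC : ∀ u m, |b u m| ≤ C)
    (hmono : ∀ u, MonotoneOn (b u) (Ici u))
    (hUd : ∀ᵐ ω ∂P, ∀ s t, 0 ≤ s → s ≤ t → U t ω - W t ω - (U s ω - W s ω)
      ≤ ∫ r in s..t, b (U r ω) (pathMax (fun s => U s ω) r))
    (hXU : ∀ t ω, X t ω ≤ U t ω) (hT : 0 < T) :
    ∫ ω, (U T ω - X T ω) ∂P ≤ 0 := by
  have hC : 0 ≤ C := (abs_nonneg _).trans (hbC 0 0)
  obtain ⟨KU, hKU⟩ := hU.exists_occupationMeasure_tail hW hC (l := 8 * C + 1) (by positivity) hT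
  obtain ⟨KX, hKX⟩ := hX.toIsDriftedBrownian.exists_occupationMeasure_tail hW hC
    (l := 8 * C + 1) (by positivity) hT
  have hbound : ∀ R : ℝ, 0 ≤ R → ∫ ω, (U T ω - X T ω) ∂P
      ≤ Real.exp (8 * C) * C * (KU + KX) * Real.exp (-R) := by
    intro R hR
    refine (hU.integral_sub_le_occupation_tail hX hW hb hbC hmono hUd hXU hT hR).trans ?_
    refine (mul_le_mul_of_nonneg_left (add_le_add (hKU R) (hKX R)) (by positivity)).trans_eq ?_
    have h1 : Real.exp (4 * C * (R + 1)) ^ 2 * Real.exp (-(8 * C + 1) * R)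
        = Real.exp (8 * C) * Real.exp (-R) := by
      rw [← Real.exp_nat_mul, ← Real.exp_add, ← Real.exp_add]
      congr 1
      push_cast
      ring
    linear_combination C * (KU + KX) * h1
  refine ge_of_tendsto' (x := Filter.atTop)
    (f := fun R : ℕ => Real.exp (8 * C) * C * (KU + KX) * Real.exp (-(R : ℝ))) ?_
    fun R => hbound R (Nat.cast_nonneg R)
  have := (Real.tendsto_exp_neg_atTop_nhds_zero.comp tendsto_natCast_atTop_atTop).const_mul
    (Real.exp (8 * C) * C * (KU + KX))
  simpa using this

end IsDriftedBrownian

namespace IsMaxDriftSolution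

variable {Ω : Type*} {m : MeasurableSpace Ω} {P : Measure Ω} [IsProbabilityMeasure P]
  {ℱ : Filtration ℝ m} {W X Y : ℝ → Ω → ℝ} {C x T : ℝ} {b : ℝ → ℝ → ℝ}

lemma ae_le (hX : IsMaxDriftSolution P ℱ W b C x X) (hY : IsMaxDriftSolution P ℱ W b C x Y)
    (hW : IsStandardBrownianMotion P ℱ W) (hb : Measurable (Function.uncurry b))
    (hbC : ∀ u m, |b u m| ≤ C) (hmono : ∀ u, MonotoneOn (b u) (Ici u)) (hT : 0 < T) :
    ∀ᵐ ω ∂P, Y T ω ≤ X T ω := by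
  have hU := hX.isDriftedBrownian_max hbC hY
  have hle := hU.integral_sub_nonpos hX hW hb hbC hmono (hX.max_drift_le hb hbC hmono hY)
    (fun t ω => le_max_left _ _) hT
  have hnonneg : ∀ ω, 0 ≤ max (X T ω) (Y T ω) - X T ω := fun ω => sub_nonneg.2 (le_max_left _ _)
  have hzero := (integral_eq_zero_iff_of_nonneg hnonneg
    ((hU.integrable hW hT.le).sub (hX.toIsDriftedBrownian.integrable hW hT.le))).1
    (le_antisymm hle (integral_nonneg hnonneg))
  filter_upwards [hzero] with ω h
  have h1 : max (X T ω) (Y T ω) - X T ω = 0 := h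
  linarith [le_max_right (X T ω) (Y T ω)]

lemma ae_eq (hX : IsMaxDriftSolution P ℱ W b C x X) (hY : IsMaxDriftSolution P ℱ W b C x Y)
    (hW : IsStandardBrownianMotion P ℱ W) (hb : Measurable (Function.uncurry b))
    (hbC : ∀ u m, |b u m| ≤ C) (hmono : ∀ u, MonotoneOn (b u) (Ici u)) :
    ∀ᵐ ω ∂P, ∀ t, 0 ≤ t → X t ω = Y t ω := by
  have hrat : ∀ᵐ ω ∂P, ∀ q : ℚ, (0 : ℝ) < q → X q ω = Y q ω := by
    refine ae_all_iff.2 fun q => ?_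
    by_cases hq : (0 : ℝ) < q
    · filter_upwards [hX.ae_le hY hW hb hbC hmono hq, hY.ae_le hX hW hb hbC hmono hq] with ω h1 h2 _
      exact le_antisymm h2 h1
    · exact ae_of_all _ fun ω h => absurd h hq
  filter_upwards [hrat] with ω h t ht
  have hclosed : IsClosed {t | X t ω = Y t ω} := isClosed_eq (hX.cont ω) (hY.cont ω)
  have hsub : Ioi (0 : ℝ) ∩ range ((↑) : ℚ → ℝ) ⊆ {t | X t ω = Y t ω} := by
    rintro _ ⟨hr, q, rfl⟩
    exact h q hr
  have hdense : Ioi (0 : ℝ) ⊆ closure (Ioi (0 : ℝ) ∩ range ((↑) : ℚ → ℝ)) :=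
    Rat.denseRange_cast.open_subset_closure_inter isOpen_Ioi
  have h1 : closure (Ioi (0 : ℝ)) ⊆ {t | X t ω = Y t ω} :=
    closure_minimal (hdense.trans (closure_minimal hsub hclosed)) hclosed
  rw [closure_Ioi] at h1
  exact h1 ht

end IsMaxDriftSolution

/-- Pathwise uniqueness for the SDE
`Z_t = x + W_t + ∫_0^t b(Z_s, max_{0≤u≤s} Z_u) ds` with `b` bounded, measurable and, in
its second variable, strictly increasing on `{y : y ≥ x'}` for each fixed first
variable `x'`: two continuous adapted solutions `X`, `Y` driven by the same Brownian
motion are indistinguishable. -/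
theorem pathwise_uniqueness_sde_max_drift
    {Ω : Type*} {m : MeasurableSpace Ω} (P : Measure Ω) [IsProbabilityMeasure P]
    (ℱ : Filtration ℝ m) (W : ℝ → Ω → ℝ)
    (hW : IsStandardBrownianMotion P ℱ W)
    (x : ℝ) (b : ℝ → ℝ → ℝ)
    (hb_meas : Measurable (Function.uncurry b))
    (hb_bdd : ∃ C : ℝ, ∀ p q : ℝ, |b p q| ≤ C)
    (hb_mono : ∀ x' : ℝ, StrictMonoOn (b x') (Set.Ici x'))
    (X Y : ℝ → Ω → ℝ)
    (hX_cont : ∀ ω, Continuous fun t => X t ω)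
    (hY_cont : ∀ ω, Continuous fun t => Y t ω)
    (hX_adapted : Adapted ℱ X) (hY_adapted : Adapted ℱ Y)
    (hX_sol : ∀ᵐ ω ∂P, ∀ t : ℝ, 0 ≤ t →
      X t ω = x + W t ω +
        ∫ s in (0:ℝ)..t, b (X s ω) (sSup ((fun u => X u ω) '' Set.Icc 0 s)))
    (hY_sol : ∀ᵐ ω ∂P, ∀ t : ℝ, 0 ≤ t →
      Y t ω = x + W t ω +
        ∫ s in (0:ℝ)..t, b (Y s ω) (sSup ((fun u => Y u ω) '' Set.Icc 0 s))) :
    ∀ᵐ ω ∂P, ∀ t : ℝ, 0 ≤ t → X t ω = Y t ω := by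
  obtain ⟨C, hC⟩ := hb_bdd
  exact (IsMaxDriftSolution.of_integral_equation hb_meas hC hW hX_cont hX_adapted hX_sol).ae_eq
    (.of_integral_equation hb_meas hC hW hY_cont hY_adapted hY_sol) hW hb_meas hC
    fun u => (hb_mono u).monotoneOn
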